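/- arXiv:1702.04529 — 2 statements merged into one kernel-verified Lean document; each statement's English description precedes it below -/
import Mathlib

section
/- Let SB_n denote the number of semi-Baxter permutations of size n. For every n ≥ 2, (n−1)·n²·(n+1)·(n+2)·SB_n = 24·Σ_{j=0}^{n} binomial(n, j+2)·binomial(n+1, j)·binomial(n+j+2, j+3). (Theorem 3.13, second formula.) -/
/-- `f` contains the vincular pattern 2-41-3: there are positions
`i < j` and `k > j+1` with `f (j+1) < f i < f k < f j`. -/
def Contains2413 {m : ℕ} (f : Fin m → Fin m) : Prop :=
  ∃ i j j' k : Fin m, (i : ℕ) < (j : ℕ) ∧ (j' : ℕ) = (j : ℕ) + 1 ∧ (j' : ℕ) < (k : ℕ) ∧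
    f j' < f i ∧ f i < f k ∧ f k < f j

/-- A semi-Baxter permutation avoids 2-41-3. -/
def IsSemiBaxter {n : ℕ} (π : Equiv.Perm (Fin n)) : Prop := ¬ Contains2413 ⇑π

/-- The number of semi-Baxter permutations of size `n`. -/
noncomputable def semiBaxterCount (n : ℕ) : ℕ :=
  Nat.card {π : Equiv.Perm (Fin n) // IsSemiBaxter π}

namespace SemiBaxter

open MvPolynomial

/-- The first variable of `ℤ[a, c]`. -/
noncomputable abbrev a : MvPolynomial (Fin 2) ℤ := X 0

/-- The second variable of `ℤ[a, c]`. -/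
noncomputable abbrev c : MvPolynomial (Fin 2) ℤ := X 1

/-- The functional extracting the coefficient of `a ^ p * c ^ q`. -/
noncomputable def coeffAC (p q : ℕ) : MvPolynomial (Fin 2) ℤ →ₗ[ℤ] ℤ :=
  lcoeff ℤ (Finsupp.single 0 p + Finsupp.single 1 q)

lemma coeffAC_apply (p q : ℕ) (F : MvPolynomial (Fin 2) ℤ) :
    coeffAC p q F = coeff (Finsupp.single 0 p + Finsupp.single 1 q) F := rfl

lemma coeffAC_a_mul (p q : ℕ) (F : MvPolynomial (Fin 2) ℤ) :
    coeffAC (p + 1) q (a * F) = coeffAC p q F := by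
  rw [coeffAC_apply, coeffAC_apply, Finsupp.single_add, add_right_comm, add_comm, coeff_X_mul]

lemma coeffAC_c_mul (p q : ℕ) (F : MvPolynomial (Fin 2) ℤ) :
    coeffAC p (q + 1) (c * F) = coeffAC p q F := by
  rw [coeffAC_apply, coeffAC_apply, Finsupp.single_add, ← add_assoc, add_comm, coeff_X_mul]

lemma coeffAC_zero_a_mul (q : ℕ) (F : MvPolynomial (Fin 2) ℤ) :
    coeffAC 0 q (a * F) = 0 := by
  rw [coeffAC_apply, coeff_X_mul']
  simp

lemma coeffAC_zero_c_mul (p : ℕ) (F : MvPolynomial (Fin 2) ℤ) :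
    coeffAC p 0 (c * F) = 0 := by
  rw [coeffAC_apply, coeff_X_mul']
  simp

lemma coeffAC_a_mul_pderiv (p q : ℕ) (F : MvPolynomial (Fin 2) ℤ) :
    coeffAC p q (a * pderiv 0 F) = p * coeffAC p q F := by
  cases p with
  | zero => rw [coeffAC_zero_a_mul]; simp
  | succ p =>
    rw [coeffAC_a_mul, coeffAC_apply, coeffAC_apply, coeff_pderiv, Finsupp.single_add]
    simp only [Finsupp.coe_add, Pi.add_apply, Finsupp.single_eq_same]
    rw [add_right_comm]
    simp
    ring

lemma coeffAC_c_mul_pderiv (p q : ℕ) (F : MvPolynomial (Fin 2) ℤ) :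
    coeffAC p q (c * pderiv 1 F) = q * coeffAC p q F := by
  cases q with
  | zero => rw [coeffAC_zero_c_mul]; simp
  | succ q =>
    rw [coeffAC_c_mul, coeffAC_apply, coeffAC_apply, coeff_pderiv, Finsupp.single_add]
    simp only [Finsupp.coe_add, Pi.add_apply, Finsupp.single_eq_same]
    rw [add_assoc]
    simp
    ring

lemma coeffAC_natCast_mul (p q n : ℕ) (F : MvPolynomial (Fin 2) ℤ) :
    coeffAC p q ((n : MvPolynomial (Fin 2) ℤ) * F) = n * coeffAC p q F := by
  rw [← nsmul_eq_mul, map_nsmul, nsmul_eq_mul]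

lemma pderiv_two (i : Fin 2) : pderiv i (2 : MvPolynomial (Fin 2) ℤ) = 0 := by
  simpa using (pderiv (R := ℤ) i).map_natCast 2

/-- The coefficient form of the vanishing of the residue of `d (u ^ (-(e + 1)))`, where
`u = a * c / (1 + a)` and `d` is the derivation fixing `a + c`. -/
lemma coeffAC_exact_a (e : ℕ) (g : MvPolynomial (Fin 2) ℤ) (hg : pderiv 0 g = pderiv 1 g) :
    coeffAC (e + 1) (e + 1) ((1 + a) ^ e * ((1 + a) ^ 2 - (1 + a + c)) * g) = 0 := by
  set G := (1 + a) ^ (e + 1) * g with hG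
  have h1 : coeffAC (e + 1) (e + 1) (c * (a * pderiv 0 G)) =
      ((e + 1 : ℕ) : ℤ) * coeffAC (e + 1) (e + 1) (c * G) := by
    rw [coeffAC_c_mul, coeffAC_c_mul, coeffAC_a_mul_pderiv]
  have h2 : coeffAC (e + 1) (e + 1) (a * (c * pderiv 1 G)) =
      ((e + 1 : ℕ) : ℤ) * coeffAC (e + 1) (e + 1) (a * G) := by
    rw [coeffAC_a_mul, coeffAC_a_mul, coeffAC_c_mul_pderiv]
  rw [← coeffAC_natCast_mul] at h1 h2
  have h3 : c * (a * pderiv 0 G) - ((e + 1 : ℕ) : MvPolynomial (Fin 2) ℤ) * (c * G) -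
      (a * (c * pderiv 1 G) - ((e + 1 : ℕ) : MvPolynomial (Fin 2) ℤ) * (a * G)) =
      ((e + 1 : ℕ) : MvPolynomial (Fin 2) ℤ) *
        ((1 + a) ^ e * ((1 + a) ^ 2 - (1 + a + c)) * g) := by
    rw [hG]
    simp only [Derivation.leibniz, Derivation.leibniz_pow, map_add, pderiv_X_self,
      pderiv_one, smul_eq_mul, hg, nsmul_eq_mul, add_tsub_cancel_right, zero_add,
      pderiv_X_of_ne (show (0 : Fin 2) ≠ 1 by decide), mul_zero, add_zero, mul_one]
    push_cast
    ring
  have h4 := congrArg (coeffAC (e + 1) (e + 1)) h3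
  rw [map_sub, map_sub, map_sub, h1, h2, sub_self, sub_self, sub_self,
    coeffAC_natCast_mul] at h4
  have h5 : ((e + 1 : ℕ) : ℤ) ≠ 0 := by positivity
  exact (mul_eq_zero.mp h4.symm).resolve_left h5

/-- The coefficient form of the vanishing of the residue of `d (w ^ (e + 1))`, where
`w = (1 + a + c) * (a + c) / c` and `d` is the derivation fixing `a`. -/
lemma coeffAC_exact_c (p e : ℕ) (g : MvPolynomial (Fin 2) ℤ) (hg : pderiv 1 g = 0) :
    coeffAC p (e + 1) (((1 + a + c) * (a + c)) ^ e *
      ((1 + a + c) ^ 2 - 2 * (1 + a) * (1 + a + c) + (1 + a)) * g) = 0 := by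
  set G := ((1 + a + c) * (a + c)) ^ (e + 1) * g with hG
  have h1 := coeffAC_c_mul_pderiv p (e + 1) G
  rw [← coeffAC_natCast_mul] at h1
  have h3 : c * pderiv 1 G - ((e + 1 : ℕ) : MvPolynomial (Fin 2) ℤ) * G =
      ((e + 1 : ℕ) : MvPolynomial (Fin 2) ℤ) * (((1 + a + c) * (a + c)) ^ e *
        ((1 + a + c) ^ 2 - 2 * (1 + a) * (1 + a + c) + (1 + a)) * g) := by
    rw [hG]
    simp only [Derivation.leibniz, Derivation.leibniz_pow, map_add, pderiv_X_self,
      pderiv_one, smul_eq_mul, hg, nsmul_eq_mul, add_tsub_cancel_right, zero_add,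
      pderiv_X_of_ne (show (0 : Fin 2) ≠ 1 by decide), mul_zero, add_zero, mul_one]
    push_cast
    ring
  have h4 := congrArg (coeffAC p (e + 1)) h3
  rw [map_sub, h1, sub_self, coeffAC_natCast_mul] at h4
  have h5 : ((e + 1 : ℕ) : ℤ) ≠ 0 := by positivity
  exact (mul_eq_zero.mp h4.symm).resolve_left h5

/-- The product of the equations of the five reflection curves of the kernel, where
`y = 1 + a` and `z = 1 + a + c`. -/
noncomputable def reflectionProd : MvPolynomial (Fin 2) ℤ :=
  ((1 + a) ^ 2 - (1 + a + c)) *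
  ((1 + a + c) ^ 2 - 2 * (1 + a) * (1 + a + c) + (1 + a)) *
  ((1 + a + c) * (1 + a) - 2 * (1 + a + c) + 1) *
  (c - 1) * ((1 + a + c) * (1 + a) - (1 + a + c) - (1 + a))

lemma coeffAC_boundary_left (M k : ℕ) :
    coeffAC (M + 3) (M + 3) ((1 + a) ^ M * (1 + a + c) ^ k * (a + c) ^ (M + 2) *
      reflectionProd) = 0 := by
  have key : (1 + a) ^ M * (1 + a + c) ^ k * (a + c) ^ (M + 2) * reflectionProd =
      (1 + a) ^ (M + 2) * ((1 + a) ^ 2 - (1 + a + c)) *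
        (-(1 + a + c) ^ k * (a + c) ^ (M + 5) * (1 - (a + c))) +
      a * (c * ((1 + a) ^ (M + 1) * ((1 + a) ^ 2 - (1 + a + c)) *
        ((1 + a + c) ^ k * (a + c) ^ (M + 2) *
          ((1 + a + c) * (2 * (a + c) + 1) * (1 - (a + c)) - (a + c) ^ 4)))) +
      a * (c * (a * (c * ((1 + a) ^ M * ((1 + a) ^ 2 - (1 + a + c)) *
        ((1 + a + c) ^ (k + 1) * (a + c) ^ (M + 3) * (2 * (a + c) + 1)))))) := by
    rw [reflectionProd]
    ring
  rw [key, map_add, map_add, coeffAC_a_mul, coeffAC_c_mul, coeffAC_a_mul, coeffAC_c_mul,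
    coeffAC_a_mul, coeffAC_c_mul, coeffAC_exact_a, coeffAC_exact_a, coeffAC_exact_a]
  · rfl
  all_goals
    simp only [Derivation.leibniz, Derivation.leibniz_pow, map_add, map_sub, map_neg,
      pderiv_X_self, pderiv_one, pderiv_two,
      pderiv_X_of_ne (show (0 : Fin 2) ≠ 1 by decide),
      pderiv_X_of_ne (show (1 : Fin 2) ≠ 0 by decide), add_zero, zero_add]

lemma coeffAC_boundary_bottom (p i e : ℕ) :
    coeffAC p (e + 3) ((1 + a) ^ i * ((1 + a + c) * (a + c)) ^ e * reflectionProd) = 0 := by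
  have key : (1 + a) ^ i * ((1 + a + c) * (a + c)) ^ e * reflectionProd =
      c * (c * (((1 + a + c) * (a + c)) ^ e *
        ((1 + a + c) ^ 2 - 2 * (1 + a) * (1 + a + c) + (1 + a)) *
          ((1 + a) ^ i * ((1 + a) ^ 2 + (1 + a))))) +
      c * (((1 + a + c) * (a + c)) ^ (e + 1) *
        ((1 + a + c) ^ 2 - 2 * (1 + a) * (1 + a + c) + (1 + a)) *
          ((1 + a) ^ i * (((1 + a) ^ 2 + (1 + a)) * (a - 1) * a - 1))) +
      ((1 + a + c) * (a + c)) ^ (e + 2) *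
        ((1 + a + c) ^ 2 - 2 * (1 + a) * (1 + a + c) + (1 + a)) *
          (-(1 + a) ^ i * ((a - 1) * a)) := by
    rw [reflectionProd]
    ring
  rw [key, map_add, map_add, coeffAC_c_mul, coeffAC_c_mul, coeffAC_c_mul,
    coeffAC_exact_c, coeffAC_exact_c, coeffAC_exact_c]
  · rfl
  all_goals
    simp [Derivation.leibniz, Derivation.leibniz_pow,
      pderiv_X_of_ne (show (0 : Fin 2) ≠ 1 by decide)]

/-- Total derivatives have no residue. -/
lemma coeffAC_total_derivative (i j l p q : ℕ) (A B : MvPolynomial (Fin 2) ℤ) :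
    coeffAC (p + 1) (q + 1) ((1 + a) ^ i * (1 + a + c) ^ j * (a + c) ^ l *
      (c * (a * ((i + 1) * ((1 + a + c) * (a + c)) + (j + 1) * ((1 + a) * (a + c)) +
          (l + 1) * ((1 + a) * (1 + a + c))) * A +
        (1 + a) * (1 + a + c) * (a + c) * (a * pderiv 0 A - (p + 1) * A)) +
      a * (c * ((j + 1) * ((1 + a) * (a + c)) + (l + 1) * ((1 + a) * (1 + a + c))) * B +
        (1 + a) * (1 + a + c) * (a + c) * (c * pderiv 1 B - (q + 1) * B)))) = 0 := by
  have h1 := coeffAC_a_mul_pderiv (p + 1) q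
    ((1 + a) ^ (i + 1) * (1 + a + c) ^ (j + 1) * (a + c) ^ (l + 1) * A)
  have h2 := coeffAC_c_mul_pderiv p (q + 1)
    ((1 + a) ^ (i + 1) * (1 + a + c) ^ (j + 1) * (a + c) ^ (l + 1) * B)
  rw [← coeffAC_natCast_mul, ← sub_eq_zero, ← map_sub] at h1 h2
  rw [← coeffAC_c_mul] at h1
  rw [← coeffAC_a_mul] at h2
  have h3 := congrArg₂ (· + ·) h1 h2
  simp only [← map_add, add_zero] at h3
  refine Eq.trans (congrArg _ ?_) h3
  simp only [Derivation.leibniz, Derivation.leibniz_pow, map_add, pderiv_X_self,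
    pderiv_one, smul_eq_mul, nsmul_eq_mul, add_tsub_cancel_right, zero_add,
    pderiv_X_of_ne (show (0 : Fin 2) ≠ 1 by decide),
    pderiv_X_of_ne (show (1 : Fin 2) ≠ 0 by decide), mul_zero, add_zero, mul_one]
  push_cast
  ring

lemma pderiv_natCast (i : Fin 2) (n : ℕ) : pderiv i (n : MvPolynomial (Fin 2) ℤ) = 0 :=
  (pderiv (R := ℤ) i).map_natCast n

lemma pderiv_ofNat (i : Fin 2) (n : ℕ) [n.AtLeastTwo] :
    pderiv i (ofNat(n) : MvPolynomial (Fin 2) ℤ) = 0 := by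
  have h := pderiv_natCast i (ofNat(n))
  rwa [Nat.cast_ofNat] at h

set_option maxHeartbeats 4000000 in
set_option maxRecDepth 10000 in
lemma coeffAC_corner (k : ℕ) :
    coeffAC (k + 3) (k + 4) ((1 + a) ^ k * (1 + a + c) ^ (k + 1) * (a + c) ^ (k + 2) *
      reflectionProd) = 0 := by
  have key (K : MvPolynomial (Fin 2) ℤ) (hK : ∀ i, pderiv i K = 0) :
      ∃ A B : MvPolynomial (Fin 2) ℤ,
      (K + 1) * (K + 2) * (K + 3) * (K + 4) * (K + 5) * (a * reflectionProd) =
      c * (a * ((K + 1) * ((1 + a + c) * (a + c)) + ((K + 1) + 1) * ((1 + a) * (a + c)) +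
          ((K + 2) + 1) * ((1 + a) * (1 + a + c))) * A +
        (1 + a) * (1 + a + c) * (a + c) * (a * pderiv 0 A - ((K + 3) + 1) * A)) +
      a * (c * (((K + 1) + 1) * ((1 + a) * (a + c)) + ((K + 2) + 1) * ((1 + a) * (1 + a + c))) * B +
        (1 + a) * (1 + a + c) * (a + c) * (c * pderiv 1 B - ((K + 3) + 1) * B)) := by
    refine ⟨
      (-2 * K ^ 2 - 10 * K - 24) * (a * c) +
      (-K ^ 4 - 14 * K ^ 3 - 71 * K ^ 2 - 154 * K - 120) * (a * c ^ 2) +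
      (2 * K ^ 4 + 28 * K ^ 3 + 142 * K ^ 2 + 308 * K + 240) * (a * c ^ 3) +
      (K ^ 4 + 15 * K ^ 3 + 75 * K ^ 2 + 161 * K + 132) * (a ^ 2) +
      (-2 * K ^ 4 - 22 * K ^ 3 - 95 * K ^ 2 - 182 * K - 147) * (a ^ 2 * c) +
      (K ^ 4 + 20 * K ^ 3 + 110 * K ^ 2 + 248 * K + 213) * (a ^ 3) +
      (-2 * K ^ 4 - 20 * K ^ 3 - 80 * K ^ 2 - 146 * K - 108) * (a ^ 3 * c) +
      (6 * K ^ 3 + 40 * K ^ 2 + 94 * K + 84) * (a ^ 4) +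
      (K ^ 3 + 7 * K ^ 2 + 15 * K + 9) * (a ^ 4 * c) +
      (-K ^ 2 - 4 * K - 3) * (a ^ 5) +
      (-K ^ 3 - 6 * K ^ 2 - 11 * K - 6) * (a ^ 5 * c) +
      (-K ^ 3 - 6 * K ^ 2 - 11 * K - 6) * (a ^ 6),
      (-2 * K ^ 3 - 16 * K ^ 2 - 54 * K - 72) * (c ^ 2) +
      (-4 * K ^ 3 - 28 * K ^ 2 - 64 * K - 48) * (c ^ 3) +
      (2 * K ^ 4 + 24 * K ^ 3 + 106 * K ^ 2 + 204 * K + 144) * (c ^ 4) +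
      (-K ^ 4 - 11 * K ^ 3 - 37 * K ^ 2 - 39 * K + 4) * (a * c) +
      (-3 * K ^ 3 - 14 * K ^ 2 - 17 * K - 14) * (a * c ^ 2) +
      (-5 * K ^ 3 - 42 * K ^ 2 - 115 * K - 102) * (a * c ^ 3) +
      (-K ^ 4 - 10 * K ^ 3 - 35 * K ^ 2 - 50 * K - 24) * (a * c ^ 4) +
      (2 * K ^ 4 + 28 * K ^ 3 + 140 * K ^ 2 + 306 * K + 264) * (a ^ 2 * c) +
      (-K ^ 4 - 7 * K ^ 3 - 20 * K ^ 2 - 27 * K - 13) * (a ^ 2 * c ^ 2) +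
      (-3 * K ^ 4 - 28 * K ^ 3 - 93 * K ^ 2 - 128 * K - 60) * (a ^ 2 * c ^ 3) +
      (K ^ 4 + 11 * K ^ 3 + 41 * K ^ 2 + 61 * K + 30) * (a ^ 3) +
      (K ^ 4 + 20 * K ^ 3 + 106 * K ^ 2 + 224 * K + 185) * (a ^ 3 * c) +
      (-3 * K ^ 4 - 25 * K ^ 3 - 76 * K ^ 2 - 99 * K - 45) * (a ^ 3 * c ^ 2) +
      (K ^ 4 + 11 * K ^ 3 + 41 * K ^ 2 + 61 * K + 30) * (a ^ 3 * c ^ 3) +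
      (-2 * K ^ 4 - 19 * K ^ 3 - 67 * K ^ 2 - 101 * K - 51) * (a ^ 4 * c) +
      (2 * K ^ 4 + 21 * K ^ 3 + 76 * K ^ 2 + 111 * K + 54) * (a ^ 4 * c ^ 2) +
      (-K ^ 4 - 11 * K ^ 3 - 41 * K ^ 2 - 61 * K - 30) * (a ^ 5) +
      (K ^ 4 + 10 * K ^ 3 + 35 * K ^ 2 + 50 * K + 24) * (a ^ 5 * c), ?_⟩
    rw [reflectionProd]
    simp only [Derivation.leibniz, Derivation.leibniz_pow, map_add, map_sub, map_neg, hK,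
      pderiv_X_self, pderiv_ofNat, smul_eq_mul, nsmul_eq_mul, zero_add,
      pderiv_X_of_ne (show (0 : Fin 2) ≠ 1 by decide),
      pderiv_X_of_ne (show (1 : Fin 2) ≠ 0 by decide), mul_zero, add_zero, mul_one,
      Nat.reduceSub, Nat.cast_ofNat, pow_one]
    ring
  obtain ⟨A, B, h⟩ := key k fun i => pderiv_natCast i k
  have h1 := coeffAC_total_derivative k (k + 1) (k + 2) (k + 3) (k + 3) A B
  push_cast at h1
  rw [← h] at h1
  have h2 := coeffAC_natCast_mul (k + 4) (k + 4) ((k + 1) * (k + 2) * (k + 3) * (k + 4) * (k + 5))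
    (a * ((1 + a) ^ k * (1 + a + c) ^ (k + 1) * (a + c) ^ (k + 2) * reflectionProd))
  rw [coeffAC_a_mul] at h2
  have h3 : (((k + 1) * (k + 2) * (k + 3) * (k + 4) * (k + 5) : ℕ) : ℤ) ≠ 0 := by positivity
  refine (mul_eq_zero.mp (h2.symm.trans (Eq.trans (congrArg _ ?_) h1))).resolve_left h3
  push_cast
  ring

set_option maxHeartbeats 4000000 in
set_option maxRecDepth 10000 in
lemma coeffAC_closed_formula (k : ℕ) :
    ((k + 1) * (k + 2) ^ 2 * (k + 3) * (k + 4) : ℤ) *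
      -coeffAC (k + 2) (k + 3) ((1 + a) ^ k * (1 + a + c) ^ (k + 1) * (a + c) ^ (k + 1) *
        reflectionProd) =
      24 * coeffAC (k + 3) (k + 1)
        ((1 + a) ^ (k + 2) * (1 + a + c) ^ (k + 3) * (a + c) ^ (k + 4)) := by
  have key (K : MvPolynomial (Fin 2) ℤ) (hK : ∀ i, pderiv i K = 0) :
      ∃ A B : MvPolynomial (Fin 2) ℤ,
      (K + 3) * (K + 4) * (K + 5) * (K + 6) *
        (-((K + 1) * (K + 2) ^ 2 * (K + 3) * (K + 4)) * (a * reflectionProd) -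
        24 * ((1 + a) ^ 2 * (1 + a + c) ^ 2 * (a + c) ^ 3 * c ^ 2)) =
      c * (a * ((K + 1) * ((1 + a + c) * (a + c)) + ((K + 1) + 1) * ((1 + a) * (a + c)) +
          ((K + 1) + 1) * ((1 + a) * (1 + a + c))) * A +
        (1 + a) * (1 + a + c) * (a + c) * (a * pderiv 0 A - ((K + 2) + 1) * A)) +
      a * (c * (((K + 1) + 1) * ((1 + a) * (a + c)) + ((K + 1) + 1) * ((1 + a) * (1 + a + c))) * B +
        (1 + a) * (1 + a + c) * (a + c) * (c * pderiv 1 B - ((K + 2) + 1) * B)) := by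
    refine ⟨
      (24 * K ^ 3 + 360 * K ^ 2 + 1776 * K + 2880) * (c ^ 3) +
      (24 * K ^ 3 + 360 * K ^ 2 + 1776 * K + 2880) * (c ^ 4) +
      (K ^ 6 + 15 * K ^ 5 + 83 * K ^ 4 + 237 * K ^ 3 + 468 * K ^ 2 + 636 * K + 432) * (a * c) +
      (K ^ 8 + 29 * K ^ 7 + 361 * K ^ 6 + 2519 * K ^ 5 + 10774 * K ^ 4 + 28916 * K ^ 3 +
        47544 * K ^ 2 + 43776 * K + 17280) * (a * c ^ 2) +
      (-2 * K ^ 8 - 58 * K ^ 7 - 722 * K ^ 6 - 5038 * K ^ 5 - 21548 * K ^ 4 - 57808 * K ^ 3 -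
        94728 * K ^ 2 - 85776 * K - 31680) * (a * c ^ 3) +
      (24 * K ^ 3 + 360 * K ^ 2 + 1776 * K + 2880) * (a * c ^ 4) +
      (-K ^ 8 - 30 * K ^ 7 - 378 * K ^ 6 - 2632 * K ^ 5 - 11177 * K ^ 4 - 29858 * K ^ 3 -
        49116 * K ^ 2 - 45480 * K - 18144) * (a ^ 2) +
      (2 * K ^ 8 + 53 * K ^ 7 + 616 * K ^ 6 + 4090 * K ^ 5 + 16806 * K ^ 4 + 43317 * K ^ 3 +
        68040 * K ^ 2 + 59460 * K + 22464) * (a ^ 2 * c) +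
      (-K ^ 8 - 37 * K ^ 7 - 525 * K ^ 6 - 3915 * K ^ 5 - 17338 * K ^ 4 - 47792 * K ^ 3 -
        81160 * K ^ 2 - 78624 * K - 33696) * (a ^ 3) +
      (2 * K ^ 8 + 49 * K ^ 7 + 532 * K ^ 6 + 3378 * K ^ 5 + 13610 * K ^ 4 + 34985 * K ^ 3 +
        55288 * K ^ 2 + 48972 * K + 19584) * (a ^ 3 * c) +
      (-10 * K ^ 7 - 210 * K ^ 6 - 1814 * K ^ 5 - 8534 * K ^ 4 - 24144 * K ^ 3 - 41848 * K ^ 2 -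
        42528 * K - 20160) * (a ^ 4) +
      (-2 * K ^ 7 - 43 * K ^ 6 - 365 * K ^ 5 - 1633 * K ^ 4 - 4277 * K ^ 3 - 6604 * K ^ 2 -
        5364 * K - 1008) * (a ^ 4 * c) +
      (-K ^ 7 - 23 * K ^ 6 - 199 * K ^ 5 - 893 * K ^ 4 - 2392 * K ^ 3 - 4124 * K ^ 2 - 4896 * K -
        3168) * (a ^ 5) +
      (2 * K ^ 7 + 40 * K ^ 6 + 332 * K ^ 5 + 1480 * K ^ 4 + 3818 * K ^ 3 + 5680 * K ^ 2 +
        4488 * K + 1440) * (a ^ 5 * c) +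
      (2 * K ^ 7 + 40 * K ^ 6 + 332 * K ^ 5 + 1480 * K ^ 4 + 3818 * K ^ 3 + 5680 * K ^ 2 +
        4488 * K + 1440) * (a ^ 6),
      (K ^ 7 + 17 * K ^ 6 + 113 * K ^ 5 + 403 * K ^ 4 + 942 * K ^ 3 + 1572 * K ^ 2 + 1704 * K +
        864) * (c ^ 2) +
      (5 * K ^ 7 + 107 * K ^ 6 + 945 * K ^ 5 + 4477 * K ^ 4 + 12094 * K ^ 3 + 17244 * K ^ 2 +
        8328 * K - 3744) * (c ^ 3) +
      (-2 * K ^ 8 - 52 * K ^ 7 - 578 * K ^ 6 - 3592 * K ^ 5 - 13664 * K ^ 4 - 32776 * K ^ 3 -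
        49704 * K ^ 2 - 46704 * K - 22848) * (c ^ 4) +
      (-24 * K ^ 3 - 264 * K ^ 2 - 912 * K - 960) * (c ^ 5) +
      (K ^ 8 + 27 * K ^ 7 + 306 * K ^ 6 + 1890 * K ^ 5 + 6881 * K ^ 4 + 14751 * K ^ 3 +
        17100 * K ^ 2 + 8004 * K - 432) * (a * c) +
      (5 * K ^ 7 + 89 * K ^ 6 + 579 * K ^ 5 + 1471 * K ^ 4 - 860 * K ^ 3 - 13788 * K ^ 2 -
        30120 * K - 22896) * (a * c ^ 2) +
      (9 * K ^ 7 + 201 * K ^ 6 + 1869 * K ^ 5 + 9411 * K ^ 4 + 27234 * K ^ 3 + 42396 * K ^ 2 +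
        26112 * K - 3408) * (a * c ^ 3) +
      (K ^ 8 + 25 * K ^ 7 + 265 * K ^ 6 + 1555 * K ^ 5 + 5518 * K ^ 4 + 11932 * K ^ 3 +
        14064 * K ^ 2 + 4560 * K - 4800) * (a * c ^ 4) +
      (-2 * K ^ 8 - 60 * K ^ 7 - 773 * K ^ 6 - 5593 * K ^ 5 - 24941 * K ^ 4 - 70607 * K ^ 3 -
        124788 * K ^ 2 - 126756 * K - 58032) * (a ^ 2 * c) +
      (K ^ 8 + 21 * K ^ 7 + 173 * K ^ 6 + 659 * K ^ 5 + 630 * K ^ 4 - 4820 * K ^ 3 -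
        22992 * K ^ 2 - 43944 * K - 34704) * (a ^ 2 * c ^ 2) +
      (3 * K ^ 8 + 72 * K ^ 7 + 732 * K ^ 6 + 4122 * K ^ 5 + 14061 * K ^ 4 + 29406 * K ^ 3 +
        34836 * K ^ 2 + 16656 * K - 3120) * (a ^ 2 * c ^ 3) +
      (-K ^ 8 - 27 * K ^ 7 - 309 * K ^ 6 - 1953 * K ^ 5 - 7434 * K ^ 4 - 17388 * K ^ 3 -
        24296 * K ^ 2 - 18432 * K - 5760) * (a ^ 3) +
      (-K ^ 8 - 41 * K ^ 7 - 626 * K ^ 6 - 4956 * K ^ 5 - 23041 * K ^ 4 - 66127 * K ^ 3 -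
        117140 * K ^ 2 - 120708 * K - 59328) * (a ^ 3 * c) +
      (3 * K ^ 8 + 67 * K ^ 7 + 629 * K ^ 6 + 3265 * K ^ 5 + 10280 * K ^ 4 + 19732 * K ^ 3 +
        20552 * K ^ 2 + 5520 * K - 7488) * (a ^ 3 * c ^ 2) +
      (-K ^ 8 - 26 * K ^ 7 - 286 * K ^ 6 - 1736 * K ^ 5 - 6349 * K ^ 4 - 14294 * K ^ 3 -
        19284 * K ^ 2 - 14184 * K - 4320) * (a ^ 3 * c ^ 3) +
      (2 * K ^ 8 + 48 * K ^ 7 + 491 * K ^ 6 + 2817 * K ^ 5 + 9911 * K ^ 4 + 21579 * K ^ 3 +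
        27180 * K ^ 2 + 15012 * K - 1728) * (a ^ 4 * c) +
      (-2 * K ^ 8 - 50 * K ^ 7 - 532 * K ^ 6 - 3140 * K ^ 5 - 11218 * K ^ 4 - 24770 * K ^ 3 -
        32888 * K ^ 2 - 23880 * K - 7200) * (a ^ 4 * c ^ 2) +
      (K ^ 8 + 27 * K ^ 7 + 309 * K ^ 6 + 1953 * K ^ 5 + 7434 * K ^ 4 + 17388 * K ^ 3 +
        24296 * K ^ 2 + 18432 * K + 5760) * (a ^ 5) +
      (-K ^ 8 - 24 * K ^ 7 - 246 * K ^ 6 - 1404 * K ^ 5 - 4869 * K ^ 4 - 10476 * K ^ 3 -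
        13604 * K ^ 2 - 9696 * K - 2880) * (a ^ 5 * c), ?_⟩
    rw [reflectionProd]
    simp only [Derivation.leibniz, Derivation.leibniz_pow, map_add, map_sub, map_neg, hK,
      pderiv_X_self, pderiv_ofNat, smul_eq_mul, nsmul_eq_mul, zero_add,
      pderiv_X_of_ne (show (0 : Fin 2) ≠ 1 by decide),
      pderiv_X_of_ne (show (1 : Fin 2) ≠ 0 by decide), mul_zero, add_zero, mul_one,
      Nat.reduceSub, Nat.cast_ofNat, pow_one]
    ring
  obtain ⟨A, B, h⟩ := key k fun i => pderiv_natCast i k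
  have h1 := coeffAC_total_derivative k (k + 1) (k + 1) (k + 2) (k + 2) A B
  push_cast at h1
  rw [← h] at h1
  have h2 := coeffAC_natCast_mul (k + 3) (k + 3)
    ((k + 3) * (k + 4) * (k + 5) * (k + 6) * ((k + 1) * (k + 2) ^ 2 * (k + 3) * (k + 4)))
    (a * ((1 + a) ^ k * (1 + a + c) ^ (k + 1) * (a + c) ^ (k + 1) * reflectionProd))
  have h3 := coeffAC_natCast_mul (k + 3) (k + 3)
    ((k + 3) * (k + 4) * (k + 5) * (k + 6) * 24)
    (c * (c * ((1 + a) ^ (k + 2) * (1 + a + c) ^ (k + 3) * (a + c) ^ (k + 4))))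
  rw [coeffAC_a_mul] at h2
  rw [coeffAC_c_mul, coeffAC_c_mul] at h3
  have h4 : (((k + 3) * (k + 4) * (k + 5) * (k + 6) : ℕ) : ℤ) ≠ 0 := by positivity
  have h5 := congrArg₂ (· + ·) h2 h3
  simp only [← map_add] at h5
  have h6 := h5.symm.trans (Eq.trans (b := -coeffAC (k + 3) (k + 3) _)
    (by rw [← map_neg]; exact congrArg _ (by push_cast; ring)) (neg_eq_zero.mpr h1))
  refine mul_left_cancel₀ h4 ?_
  push_cast at h6 ⊢
  linear_combination -h6

/-- The coefficient expressing the number of descendants, `m + 1` generations below, of a node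
with label `(h + 1, k)`. -/
noncomputable def weight (m h k : ℕ) : ℤ :=
  -coeffAC (m + 2) (m + 3)
    ((1 + a) ^ (h + m) * (1 + a + c) ^ (k + m) * (a + c) ^ (m + 1) * reflectionProd)

/-- `weight (m + 1)` with the first label shifted, so that it extends to the boundary. -/
noncomputable def weightExt (m h k : ℕ) : ℤ :=
  -coeffAC (m + 3) (m + 4)
    ((1 + a) ^ (h + m) * (1 + a + c) ^ (k + m + 1) * (a + c) ^ (m + 2) * reflectionProd)

lemma weight_succ (m h k : ℕ) : weight (m + 1) h k = weightExt m (h + 1) k := by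
  rw [weight, weightExt]
  ring_nf

lemma weightExt_mixed (m h k : ℕ) :
    weightExt m (h + 1) (k + 1) - weightExt m (h + 2) k -
      (weightExt m h (k + 1) - weightExt m (h + 1) k) =
    weight m h (k + 2) - weight m h (k + 1) := by
  simp only [weight, weightExt]
  rw [← coeffAC_a_mul (m + 2) (m + 3), ← coeffAC_a_mul (m + 2) (m + 3),
    ← coeffAC_c_mul (m + 3) (m + 3), ← coeffAC_c_mul (m + 3) (m + 3)]
  simp only [← map_neg, ← map_sub]
  congr 1
  ring

lemma weightExt_left (m k : ℕ) : weightExt m 0 (k + 1) = weightExt m 1 k := by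
  have h := coeffAC_boundary_left m (k + m + 1)
  rw [← coeffAC_c_mul] at h
  rw [← sub_eq_zero, weightExt, weightExt, ← neg_eq_zero, ← h]
  simp only [← map_neg, ← map_sub]
  congr 1
  ring

lemma weightExt_bottom (m h : ℕ) :
    weightExt m (h + 1) 0 - weightExt m h 0 = weight m h 1 := by
  have key := coeffAC_boundary_bottom (m + 1) (h + m) (m + 1)
  rw [← coeffAC_a_mul, ← coeffAC_a_mul, mul_pow] at key
  rw [← sub_eq_zero, weight, weightExt, weightExt, ← coeffAC_a_mul (m + 2) (m + 3),
    ← coeffAC_c_mul (m + 3) (m + 3), ← neg_eq_zero, ← key]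
  simp only [← map_neg, ← map_sub]
  congr 1
  ring

lemma weightExt_corner (m : ℕ) : weightExt m 0 0 = 0 := by
  have h := coeffAC_corner m
  rw [weightExt, zero_add, h, neg_zero]

lemma weightExt_eq_sum (m h k : ℕ) :
    weightExt m h k = ∑ i ∈ Finset.range h, weight m i (k + 1) +
      ∑ j ∈ Finset.range k, weight m (h + k - j - 1) (j + 1) := by
  have diag (h k : ℕ) : weightExt m h (k + 1) - weightExt m (h + 1) k =
      ∑ i ∈ Finset.range h, (weight m i (k + 2) - weight m i (k + 1)) := by
    induction h with
    | zero => simp [weightExt_left]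
    | succ h ih => rw [Finset.sum_range_succ, ← ih, ← weightExt_mixed]; ring
  induction k generalizing h with
  | zero =>
    induction h with
    | zero => simp [weightExt_corner]
    | succ h ih =>
      have := weightExt_bottom m h
      simp only [Finset.range_zero, Finset.sum_empty, add_zero, zero_add] at ih ⊢
      rw [Finset.sum_range_succ, ← ih]
      linarith
  | succ k ih =>
    have h1 := diag h k
    rw [ih (h + 1), Finset.sum_sub_distrib, Finset.sum_range_succ (fun i => weight m i (k + 1))]
      at h1
    rw [Finset.sum_range_succ (fun j => weight m (h + (k + 1) - j - 1) (j + 1)),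
      show h + (k + 1) - k - 1 = h by omega]
    simp only [show h + (k + 1) = h + 1 + k by omega]
    linarith

lemma coeffAC_binomial (n l p q : ℕ) : coeffAC p q ((1 + a) ^ n * (a + c) ^ l) =
    if l ≤ p + q then (l.choose q * n.choose (p + q - l) : ℤ) else 0 := by
  induction l generalizing p q with
  | zero =>
    rw [pow_zero, mul_one]
    induction n generalizing p with
    | zero =>
      rw [pow_zero, coeffAC_apply, coeff_one]
      rcases p with _ | p <;> rcases q with _ | q <;> simp [Finsupp.ext_iff]
    | succ n ih =>
      rw [pow_succ', add_mul, one_mul, map_add]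
      rcases p with _ | p
      · rw [coeffAC_zero_a_mul, ih]
        rcases q with _ | q <;> simp
      · rw [coeffAC_a_mul, ih, ih]
        rcases q with _ | q <;> simp [Nat.choose_succ_succ]
        ring
  | succ l ih =>
    have hl : (1 + a) ^ n * (a + c) ^ (l + 1) =
        a * ((1 + a) ^ n * (a + c) ^ l) + c * ((1 + a) ^ n * (a + c) ^ l) := by ring
    rw [hl, map_add]
    rcases p with _ | p <;> rcases q with _ | q <;>
      simp only [coeffAC_a_mul, coeffAC_c_mul, coeffAC_zero_a_mul, coeffAC_zero_c_mul, ih]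
    · simp
    · simp only [zero_add, add_le_add_iff_right, Nat.add_sub_add_right]
      split_ifs with h
      · rcases h.eq_or_lt with rfl | h
        · simp
        · simp [Nat.choose_eq_zero_of_lt h, Nat.choose_eq_zero_of_lt (Nat.succ_lt_succ h)]
      · rfl
    · simp only [add_zero, add_le_add_iff_right, Nat.add_sub_add_right, Nat.choose_zero_right]
    · simp only [show p + 1 + q = p + (q + 1) by ring, show p + 1 + (q + 1) = p + (q + 1) +
      1 by ring,
        add_le_add_iff_right, Nat.add_sub_add_right, Nat.choose_succ_succ]
      split_ifs
      · push_cast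
        ring
      · rfl

lemma exists_shifted_reflectionProd_eq : ∃ F₁ F₂ : MvPolynomial (Fin 2) ℤ,
    (a + c) * reflectionProd =
      -(a * (c * (c * (c * (1 + a))))) + a * (a * (a * F₁)) + c * (c * (c * (c * F₂))) := by
  refine ⟨c + c ^ 2 + c ^ 5 - 3 * c ^ 6 + a * c - 2 * a * c ^ 5 + a * c ^ 6 - a ^ 2 -
      2 * a ^ 2 * c + 3 * a ^ 2 * c ^ 5 - 2 * a ^ 3 + 2 * a ^ 3 * c ^ 2 - 2 * a ^ 3 * c ^ 3 +
      2 * a ^ 3 * c ^ 4 + 4 * a ^ 4 * c - 2 * a ^ 4 * c ^ 2 - 2 * a ^ 4 * c ^ 3 + 2 * a ^ 5 +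
      a ^ 5 * c - 3 * a ^ 5 * c ^ 2 + a ^ 6 - a ^ 6 * c,
    c - c ^ 2 + a - a * c + a * c ^ 3 + 2 * a ^ 2 * c ^ 2 - a ^ 2 * c ^ 3, ?_⟩
  rw [reflectionProd]
  ring

lemma coeffAC_zero_zero (h k : ℕ) :
    coeffAC 0 0 ((1 + a) ^ h * (1 + a + c) ^ k) = 1 := by
  rw [coeffAC_apply, Finsupp.single_zero, Finsupp.single_zero, add_zero,
    ← constantCoeff_eq]
  simp

lemma coeffAC_lowest (h k : ℕ) : coeffAC 1 3
    ((1 + a) ^ h * (1 + a + c) ^ k * ((a + c) * reflectionProd)) = -1 ∧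
    coeffAC 2 2 ((1 + a) ^ h * (1 + a + c) ^ k * ((a + c) * reflectionProd)) = 0 ∧
    coeffAC 2 3 ((a + c) * reflectionProd) = -1 := by
  obtain ⟨F₁, F₂, hF⟩ := exists_shifted_reflectionProd_eq
  have hY (Y : MvPolynomial (Fin 2) ℤ) : Y * ((a + c) * reflectionProd) =
      -(a * (c * (c * (c * (Y * (1 + a)))))) + a * (a * (a * (Y * F₁))) +
        c * (c * (c * (c * (Y * F₂)))) := by
    rw [hF]
    ring
  refine ⟨?_, ?_, ?_⟩
  · rw [hY, map_add, map_add, map_neg, coeffAC_a_mul 0, coeffAC_c_mul 0 2, coeffAC_c_mul 0 1,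
      coeffAC_c_mul 0 0, coeffAC_a_mul 0, coeffAC_zero_a_mul, coeffAC_c_mul 1 2,
      coeffAC_c_mul 1 1, coeffAC_c_mul 1 0, coeffAC_zero_c_mul, mul_right_comm, ← pow_succ,
      coeffAC_zero_zero]
    rfl
  · rw [hY, map_add, map_add, map_neg, coeffAC_a_mul 1, coeffAC_c_mul 1 1, coeffAC_c_mul 1 0,
      coeffAC_zero_c_mul, coeffAC_a_mul 1, coeffAC_a_mul 0, coeffAC_zero_a_mul,
      coeffAC_c_mul 2 1, coeffAC_c_mul 2 0, coeffAC_zero_c_mul]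
    rfl
  · rw [hF, map_add, map_add, map_neg, coeffAC_a_mul 1, coeffAC_c_mul 1 2, coeffAC_c_mul 1 1,
      coeffAC_c_mul 1 0, coeffAC_a_mul 1, coeffAC_a_mul 0, coeffAC_zero_a_mul,
      coeffAC_c_mul 2 2, coeffAC_c_mul 2 1, coeffAC_c_mul 2 0, coeffAC_zero_c_mul]
    have := coeffAC_binomial 1 0 1 0
    rw [pow_one, pow_zero, mul_one] at this
    rw [this]
    rfl

lemma weight_zero (h k : ℕ) : weight 0 h k = h + 1 + k := by
  simp only [weight, zero_add, add_zero, pow_one, mul_assoc _ (a + c)]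
  induction k with
  | zero =>
    induction h with
    | zero => simp [(coeffAC_lowest 0 0).2.2]
    | succ h ih =>
      rw [pow_zero, mul_one] at ih ⊢
      rw [show (1 + a) ^ (h + 1) * ((a + c) * reflectionProd) =
        (1 + a) ^ h * ((a + c) * reflectionProd) +
        a * ((1 + a) ^ h * (1 + a + c) ^ 0 * ((a + c) * reflectionProd)) by ring,
        map_add, coeffAC_a_mul 1, (coeffAC_lowest h 0).1, neg_add, ih]
      push_cast
      ring
  | succ k ih =>
    rw [show (1 + a) ^ h * (1 + a + c) ^ (k + 1) * ((a + c) * reflectionProd) =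
      (1 + a) ^ h * (1 + a + c) ^ k * ((a + c) * reflectionProd) +
      (a * ((1 + a) ^ h * (1 + a + c) ^ k * ((a + c) * reflectionProd)) +
      c * ((1 + a) ^ h * (1 + a + c) ^ k * ((a + c) * reflectionProd))) by ring,
      map_add, map_add, coeffAC_a_mul 1, coeffAC_c_mul 2 2, (coeffAC_lowest h k).1,
      (coeffAC_lowest h k).2.1, neg_add, ih]
    push_cast
    ring


/-- The number of descendants, `m` generations below, of a node with label `(h, k)` in the
generating tree of semi-Baxter permutations. -/
def descendants : ℕ → ℕ → ℕ → ℕ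
  | 0, _, _ => 1
  | m + 1, h, k => ∑ i ∈ Finset.range h, descendants m (i + 1) (k + 1) +
      ∑ j ∈ Finset.range k, descendants m (h + k - j) (j + 1)

lemma descendants_succ_eq_weight (m h k : ℕ) :
    (descendants (m + 1) (h + 1) k : ℤ) = weight m h k := by
  induction m generalizing h k with
  | zero => simp [descendants, weight_zero]
  | succ m ih =>
    rw [weight_succ, weightExt_eq_sum, descendants]
    push_cast
    simp only [ih]
    congr 1
    refine Finset.sum_congr rfl fun j hj => ?_
    have := Finset.mem_range.mp hj
    rw [← ih, show h + 1 + k - j - 1 + 1 = h + 1 + k - j by omega]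

lemma coeffAC_closed_formula_rhs (k : ℕ) :
    coeffAC (k + 3) (k + 1) ((1 + a) ^ (k + 2) * (1 + a + c) ^ (k + 3) * (a + c) ^ (k + 4)) =
      ∑ j ∈ Finset.range (k + 2 + 1),
        ((k + 2).choose (j + 2) * (k + 2 + 1).choose j * (k + 2 + j + 2).choose (j + 3) : ℤ) := by
  have hz : (1 + a) ^ (k + 2) * (1 + a + c) ^ (k + 3) * (a + c) ^ (k + 4) =
      ∑ j ∈ Finset.range (k + 3 + 1), (((k + 3).choose j : ℕ) : MvPolynomial (Fin 2) ℤ) *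
        ((1 + a) ^ (k + 2) * (a + c) ^ (k + 4 + j)) := by
    rw [show 1 + a + c = (a + c) + 1 by ring, add_pow (a + c), Finset.mul_sum, Finset.sum_mul]
    refine Finset.sum_congr rfl fun j _ => ?_
    ring
  rw [hz, map_sum, Finset.sum_range_succ]
  simp only [coeffAC_natCast_mul, coeffAC_binomial]
  rw [if_neg (by omega), mul_zero, add_zero]
  refine Finset.sum_congr rfl fun j _ => ?_
  split_ifs with h
  · rw [show k + 3 + (k + 1) - (k + 4 + j) = k + 2 - (j + 2) by omega,
      Nat.choose_symm (by omega), show k + 2 + j + 2 = (k + 1) + (j + 3) by ring,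
      show k + 4 + j = (k + 1) + (j + 3) by ring, Nat.choose_symm_add]
    ring
  · rw [Nat.choose_eq_zero_of_lt (show k + 2 < j + 2 by omega)]
    simp

theorem descendants_closed_formula (k : ℕ) :
    ((k + 1) * (k + 2) ^ 2 * (k + 3) * (k + 4) : ℤ) * descendants (k + 1) 1 1 =
      24 * ∑ j ∈ Finset.range (k + 2 + 1),
        ((k + 2).choose (j + 2) * (k + 2 + 1).choose j * (k + 2 + j + 2).choose (j + 3) : ℤ) := by
  rw [descendants_succ_eq_weight k 0 1, ← coeffAC_closed_formula_rhs, ← coeffAC_closed_formula,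
    weight, zero_add, add_comm 1 k]

open Equiv

/-- Appending the value `x` at the end of a permutation, shifting the values above it. -/
def appendValue {n : ℕ} (π : Perm (Fin n)) (x : Fin (n + 1)) : Perm (Fin (n + 1)) :=
  finSuccEquivLast.trans ((optionCongr π).trans (finSuccEquiv' x).symm)

lemma appendValue_last {n : ℕ} (π : Perm (Fin n)) (x : Fin (n + 1)) :
    appendValue π x (Fin.last n) = x := by
  simp [appendValue]

lemma appendValue_castSucc {n : ℕ} (π : Perm (Fin n)) (x : Fin (n + 1)) (i : Fin n) :
    appendValue π x i.castSucc = x.succAbove (π i) := by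
  simp [appendValue]

lemma appendValue_castSucc_val {n : ℕ} (π : Perm (Fin n)) (x : Fin (n + 1)) (i : Fin n) :
    (appendValue π x i.castSucc : ℕ) = if (π i : ℕ) < x then (π i : ℕ) else π i + 1 := by
  rw [appendValue_castSucc, Fin.succAbove]
  simp only [Fin.lt_def, Fin.val_castSucc]
  split_ifs <;> simp

lemma appendValue_bijective (n : ℕ) :
    Function.Bijective fun p : Perm (Fin n) × Fin (n + 1) => appendValue p.1 p.2 := by
  rw [Fintype.bijective_iff_injective_and_card]
  constructor
  · rintro ⟨π, x⟩ ⟨ρ, y⟩ h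
    have hx : x = y := by
      have := congrArg (fun σ : Perm (Fin (n + 1)) => σ (Fin.last n)) h
      simpa only [appendValue_last] using this
    subst hx
    have hπ : π = ρ := by
      ext i : 1
      have := congrArg (fun σ : Perm (Fin (n + 1)) => σ i.castSucc) h
      simp only [appendValue_castSucc] at this
      exact Fin.succAbove_right_injective this
    rw [hπ]
  · simp [Fintype.card_perm, Nat.factorial_succ, mul_comm]

/-- Appending the value `x` to `π` creates an occurrence of 2-41-3 that ends at `x`. -/
def Blocked {n : ℕ} (π : Perm (Fin n)) (x : ℕ) : Prop :=
  ∃ i j j' : Fin n, (i : ℕ) < j ∧ (j' : ℕ) = j + 1 ∧ (π j' : ℕ) < π i ∧ (π i : ℕ) < x ∧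
    x ≤ (π j : ℕ)

lemma contains2413_appendValue {n : ℕ} (π : Perm (Fin n)) (x : Fin (n + 1)) :
    Contains2413 (appendValue π x) ↔ Contains2413 π ∨ Blocked π x := by
  constructor
  · rintro ⟨i, j, j', k, hij, hj, hk, h1, h2, h3⟩
    have hkn := k.is_le
    obtain ⟨i, rfl⟩ := Fin.exists_castSucc_eq.mpr (show i ≠ Fin.last n by
      simp only [ne_eq, Fin.ext_iff, Fin.val_last]; omega)
    obtain ⟨j, rfl⟩ := Fin.exists_castSucc_eq.mpr (show j ≠ Fin.last n by
      simp only [ne_eq, Fin.ext_iff, Fin.val_last]; omega)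
    obtain ⟨j', rfl⟩ := Fin.exists_castSucc_eq.mpr (show j' ≠ Fin.last n by
      simp only [ne_eq, Fin.ext_iff, Fin.val_last]; omega)
    obtain rfl | ⟨k, rfl⟩ := (Fin.eq_castSucc_or_eq_last k).symm
    · right
      refine ⟨i, j, j', hij, hj, ?_⟩
      simp only [Fin.lt_def, appendValue_castSucc_val, appendValue_last] at h1 h2 h3
      split_ifs at h1 h2 h3 <;> omega
    · left
      simp only [appendValue_castSucc, Fin.succAbove_lt_succAbove_iff] at h1 h2 h3
      exact ⟨i, j, j', k, hij, hj, hk, h1, h2, h3⟩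
  · rintro (⟨i, j, j', k, hij, hj, hk, h⟩ | ⟨i, j, j', hij, hj, h⟩)
    · refine ⟨i.castSucc, j.castSucc, j'.castSucc, k.castSucc, hij, hj, hk, ?_⟩
      simpa only [appendValue_castSucc, Fin.succAbove_lt_succAbove_iff] using h
    · refine ⟨i.castSucc, j.castSucc, j'.castSucc, Fin.last n, hij, hj, j'.is_lt, ?_⟩
      simp only [Fin.lt_def, appendValue_castSucc_val, appendValue_last]
      split_ifs <;> omega

lemma blocked_appendValue {n : ℕ} (π : Perm (Fin (n + 1))) (x : Fin (n + 2)) (y : ℕ) :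
    Blocked (appendValue π x) y ↔ Blocked π (if y ≤ x then y else y - 1) ∨
      (x : ℕ) + 1 < y ∧ y ≤ π (Fin.last n) + 1 := by
  constructor
  · rintro ⟨i, j, j', hij, hj, h⟩
    have hjn := j'.is_le
    obtain ⟨i, rfl⟩ := Fin.exists_castSucc_eq.mpr (show i ≠ Fin.last (n + 1) by
      simp only [ne_eq, Fin.ext_iff, Fin.val_last]; omega)
    obtain ⟨j, rfl⟩ := Fin.exists_castSucc_eq.mpr (show j ≠ Fin.last (n + 1) by
      simp only [ne_eq, Fin.ext_iff, Fin.val_last]; omega)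
    obtain rfl | ⟨j', rfl⟩ := (Fin.eq_castSucc_or_eq_last j').symm
    · right
      have hl : j = Fin.last n := by
        simp only [Fin.ext_iff, Fin.val_last, Fin.val_castSucc] at hj ⊢
        omega
      subst hl
      simp only [appendValue_castSucc_val, appendValue_last] at h
      split_ifs at h <;> omega
    · left
      refine ⟨i, j, j', hij, hj, ?_⟩
      simp only [appendValue_castSucc_val] at h
      split_ifs at h ⊢ <;> omega
  · rintro (⟨i, j, j', hij, hj, h⟩ | ⟨h1, h2⟩)
    · refine ⟨i.castSucc, j.castSucc, j'.castSucc, hij, hj, ?_⟩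
      simp only [appendValue_castSucc_val]
      split_ifs at h ⊢ <;> omega
    · have hl := (π (Fin.last n)).is_le
      obtain ⟨i, hi⟩ := π.surjective ⟨x, by omega⟩
      have hi' : (π i : ℕ) = x := by rw [hi]
      have hne : i ≠ Fin.last n := by
        rintro rfl
        omega
      refine ⟨i.castSucc, (Fin.last n).castSucc, Fin.last (n + 1), ?_, by simp, ?_⟩
      · exact Fin.val_lt_last hne
      · simp only [appendValue_castSucc_val, appendValue_last]
        split_ifs <;> omega

open Classical in
/-- The values which can be appended to `π` without creating an occurrence of 2-41-3. -/
noncomputable def activeSites {n : ℕ} (π : Perm (Fin n)) : Finset ℕ :=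
  {x ∈ Finset.range (n + 1) | ¬ Blocked π x}

/-- The active sites not above the last value. -/
noncomputable def lowerSites {n : ℕ} (π : Perm (Fin (n + 1))) : Finset ℕ :=
  {x ∈ activeSites π | x ≤ π (Fin.last n)}

/-- The active sites above the last value. -/
noncomputable def upperSites {n : ℕ} (π : Perm (Fin (n + 1))) : Finset ℕ :=
  {x ∈ activeSites π | (π (Fin.last n) : ℕ) < x}

lemma lowerSites_appendValue {n : ℕ} (π : Perm (Fin (n + 1))) (x : Fin (n + 2)) :
    lowerSites (appendValue π x) = {y ∈ activeSites π | y ≤ (x : ℕ)} := by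
  ext y
  have hx := x.is_le
  simp only [lowerSites, activeSites, Finset.mem_filter, Finset.mem_range, appendValue_last,
    blocked_appendValue]
  constructor
  · rintro ⟨⟨h1, h2⟩, h3⟩
    rw [if_pos h3] at h2
    exact ⟨⟨by omega, fun h => h2 (Or.inl h)⟩, h3⟩
  · rintro ⟨⟨h1, h2⟩, h3⟩
    rw [if_pos h3]
    exact ⟨⟨by omega, fun h => h.elim h2 (by omega)⟩, h3⟩

lemma upperSites_appendValue {n : ℕ} (π : Perm (Fin (n + 1))) (x : Fin (n + 2)) :
    upperSites (appendValue π x) =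
      {y ∈ activeSites π | (x : ℕ) ≤ y ∧ ¬ ((x : ℕ) < y ∧ y ≤ π (Fin.last n))}.map
        (addRightEmbedding 1) := by
  ext y
  simp only [upperSites, activeSites, Finset.mem_filter, Finset.mem_range, appendValue_last,
    blocked_appendValue, Finset.mem_map, addRightEmbedding_apply]
  constructor
  · rintro ⟨⟨h1, h2⟩, h3⟩
    rw [if_neg (by omega)] at h2
    refine ⟨y - 1, ⟨⟨by omega, fun h => h2 (Or.inl h)⟩, by omega, fun h => h2 (Or.inr ?_)⟩,
      by omega⟩
    omega
  · rintro ⟨z, ⟨⟨h1, h2⟩, h3, h4⟩, rfl⟩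
    rw [if_neg (by omega)]
    refine ⟨⟨by omega, ?_⟩, by omega⟩
    rw [Nat.add_sub_cancel]
    rintro (h | h)
    · exact h2 h
    · exact h4 (by omega)

lemma sum_card_filter_le (S : Finset ℕ) (f : ℕ → ℕ) :
    ∑ x ∈ S, f (Finset.card {y ∈ S | y ≤ x}) = ∑ i ∈ Finset.range S.card, f (i + 1) := by
  induction S using Finset.induction_on_max with
  | empty => simp
  | insert x S hx ih =>
    have hxS : x ∉ S := fun h => (hx x h).false
    rw [Finset.sum_insert hxS, Finset.card_insert_of_notMem hxS, Finset.sum_range_succ, ← ih,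
      add_comm]
    congr 1
    · refine Finset.sum_congr rfl fun y hy => ?_
      rw [Finset.filter_insert, if_neg (by simpa using hx y hy)]
    · rw [Finset.filter_true_of_mem, Finset.card_insert_of_notMem hxS]
      simpa using fun y hy => (hx y hy).le

lemma sum_card_filter_ge (S : Finset ℕ) (f : ℕ → ℕ) :
    ∑ x ∈ S, f (Finset.card {y ∈ S | x ≤ y}) = ∑ i ∈ Finset.range S.card, f (i + 1) := by
  induction S using Finset.induction_on_min with
  | empty => simp
  | insert x S hx ih =>
    have hxS : x ∉ S := fun h => (hx x h).false
    rw [Finset.sum_insert hxS, Finset.card_insert_of_notMem hxS, Finset.sum_range_succ, ← ih,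
      add_comm]
    congr 1
    · refine Finset.sum_congr rfl fun y hy => ?_
      rw [Finset.filter_insert, if_neg (by simpa using hx y hy)]
    · rw [Finset.filter_true_of_mem, Finset.card_insert_of_notMem hxS]
      simpa using fun y hy => (hx y hy).le

/-- The number of descendants of `π` in the generating tree, `m` generations below. -/
noncomputable def descendantsOf {n : ℕ} (m : ℕ) (π : Perm (Fin (n + 1))) : ℕ :=
  descendants m (lowerSites π).card (upperSites π).card

lemma descendantsOf_appendValue_lower {n : ℕ} (m : ℕ) (π : Perm (Fin (n + 1)))
    (x : Fin (n + 2)) (hx : (x : ℕ) ∈ lowerSites π) :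
    descendantsOf m (appendValue π x) =
      descendants m (Finset.card {y ∈ lowerSites π | y ≤ (x : ℕ)}) ((upperSites π).card + 1) := by
  obtain ⟨hxa, hxl⟩ := Finset.mem_filter.mp hx
  rw [descendantsOf, lowerSites_appendValue, upperSites_appendValue, Finset.card_map]
  congr 1
  · congr 1
    ext y
    simp only [lowerSites, Finset.mem_filter]
    grind
  · have hxu : (x : ℕ) ∉ upperSites π := by simp [upperSites, hxl]
    rw [← Finset.card_insert_of_notMem hxu]
    congr 1
    ext y
    simp only [upperSites, Finset.mem_filter, Finset.mem_insert]
    grind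

lemma descendantsOf_appendValue_upper {n : ℕ} (m : ℕ) (π : Perm (Fin (n + 1)))
    (x : Fin (n + 2)) (hx : (x : ℕ) ∈ upperSites π) :
    descendantsOf m (appendValue π x) =
      descendants m
        ((lowerSites π).card + (upperSites π).card + 1 -
          Finset.card {y ∈ upperSites π | (x : ℕ) ≤ y})
        (Finset.card {y ∈ upperSites π | (x : ℕ) ≤ y}) := by
  obtain ⟨hxa, hxl⟩ := Finset.mem_filter.mp hx
  rw [descendantsOf, lowerSites_appendValue, upperSites_appendValue, Finset.card_map]
  have h1 : ({y ∈ activeSites π | y ≤ (x : ℕ)} : Finset ℕ) =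
      lowerSites π ∪ {y ∈ upperSites π | y ≤ (x : ℕ)} := by
    ext y
    simp only [lowerSites, upperSites, Finset.mem_filter, Finset.mem_union]
    grind
  have h2 : Disjoint (lowerSites π) {y ∈ upperSites π | y ≤ (x : ℕ)} := by
    rw [Finset.disjoint_left]
    simp only [lowerSites, upperSites, Finset.mem_filter]
    grind
  have h3 : upperSites π ∪ {(x : ℕ)} = {y ∈ upperSites π | y ≤ (x : ℕ)} ∪
    {y ∈ upperSites π | (x : ℕ) ≤ y} := by
    ext y
    simp only [Finset.mem_filter, Finset.mem_union, Finset.mem_singleton]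
    grind
  have h4 : ({y ∈ upperSites π | y ≤ (x : ℕ)} ∩ {y ∈ upperSites π | (x : ℕ) ≤ y} : Finset ℕ) =
    {(x : ℕ)} := by
    ext y
    simp only [Finset.mem_filter, Finset.mem_inter, Finset.mem_singleton]
    grind
  have h5 := Finset.card_union_add_card_inter {y ∈ upperSites π | y ≤ (x : ℕ)}
    {y ∈ upperSites π | (x : ℕ) ≤ y}
  rw [← h3, h4, Finset.card_singleton, Finset.union_eq_left.mpr (by simpa using hx)] at h5
  congr 1
  · rw [h1, Finset.card_union_of_disjoint h2]
    omega
  · congr 1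
    ext y
    simp only [upperSites, Finset.mem_filter]
    grind

lemma sum_descendantsOf_appendValue {n : ℕ} (m : ℕ) (π : Perm (Fin (n + 1))) :
    ∑ x : Fin (n + 2) with x.val ∈ activeSites π, descendantsOf m (appendValue π x) =
      descendantsOf (m + 1) π := by
  have hsum (P : ℕ → Prop) [DecidablePred P] (g : ℕ → ℕ) :
      ∑ x : Fin (n + 2) with x.val ∈ activeSites π ∧ P x.val, g x.val =
        ∑ x ∈ activeSites π with P x, g x := by
    refine Finset.sum_nbij (fun x : Fin (n + 2) => (x : ℕ)) ?_ ?_ ?_ ?_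
    · intro x hx
      simpa using hx
    · exact fun x _ y _ h => Fin.ext h
    · intro x hx
      simp only [Finset.coe_filter, Set.mem_ofPred_eq] at hx
      have : x < n + 2 := by
        have := hx.1
        simp only [activeSites, Finset.mem_filter, Finset.mem_range] at this
        exact this.1
      exact ⟨⟨x, this⟩, by simpa using hx, rfl⟩
    · simp
  rw [← Finset.sum_filter_add_sum_filter_not _ (fun x : Fin (n + 2) => (x : ℕ) ≤ π (Fin.last n)),
    Finset.filter_filter, Finset.filter_filter, descendantsOf, descendants]
  simp only [not_le]
  congr 1
  · rw [← sum_card_filter_le _ (fun i => descendants m i ((upperSites π).card + 1))]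
    rw [lowerSites, ← hsum]
    refine Finset.sum_congr rfl fun x hx => ?_
    rw [descendantsOf_appendValue_lower]
    · rfl
    · simpa [lowerSites] using hx
  · have := sum_card_filter_ge (upperSites π) (fun i => descendants m
      ((lowerSites π).card + (upperSites π).card + 1 - i) i)
    simp only [Nat.add_sub_add_right] at this
    rw [← this]
    conv_rhs => rw [upperSites, ← hsum]
    refine Finset.sum_congr rfl fun x hx => ?_
    rw [descendantsOf_appendValue_upper]
    · rfl
    · simpa [upperSites] using hx

open Classical in
lemma semiBaxterCount_eq_sum (n m : ℕ) : semiBaxterCount (n + 1 + m) =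
    ∑ π : Perm (Fin (n + 1)) with IsSemiBaxter π, descendantsOf m π := by
  induction m generalizing n with
  | zero => simp [semiBaxterCount, descendantsOf, descendants, Fintype.card_subtype]
  | succ m ih =>
    rw [show n + 1 + (m + 1) = n + 1 + 1 + m by ring, ih (n + 1), Finset.sum_filter,
      ← (appendValue_bijective (n + 1)).sum_comp, Fintype.sum_prod_type, Finset.sum_filter]
    refine Finset.sum_congr rfl fun π _ => ?_
    rw [← sum_descendantsOf_appendValue, Finset.sum_filter]
    split_ifs with hπ
    · refine Finset.sum_congr rfl fun x _ => ?_
      have := x.is_le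
      simp only [IsSemiBaxter, contains2413_appendValue, activeSites] at hπ ⊢
      simp [hπ, this, ite_not]
    · refine Finset.sum_eq_zero fun x _ => if_neg fun h => hπ fun hc => h ?_
      exact (contains2413_appendValue π x).mpr (Or.inl hc)

lemma semiBaxterCount_succ (m : ℕ) : semiBaxterCount (m + 1) = descendants m 1 1 := by
  have hS (π : Perm (Fin 1)) : IsSemiBaxter π := by
    rintro ⟨i, j, -, -, hij, -⟩
    omega
  have hA (π : Perm (Fin 1)) : activeSites π = {0, 1} := by
    have (x : ℕ) : ¬ Blocked π x := by
      rintro ⟨i, j, -, hij, -⟩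
      omega
    simp only [activeSites, this, not_false_eq_true, Finset.filter_true]
    rfl
  rw [add_comm, ← zero_add 1, semiBaxterCount_eq_sum]
  simp [hS, descendantsOf, lowerSites, upperSites, hA, Finset.filter_insert,
    Finset.filter_singleton]

end SemiBaxter

/-- Theorem 3.13, second closed formula for the semi-Baxter numbers. -/
theorem semiBaxter_closed_formula_two (n : ℕ) (hn : 2 ≤ n) :
    ((n : ℤ) - 1) * (n : ℤ) ^ 2 * ((n : ℤ) + 1) * ((n : ℤ) + 2) * (semiBaxterCount n : ℤ) =
      24 * ∑ j ∈ Finset.range (n + 1),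
        (Nat.choose n (j + 2) * Nat.choose (n + 1) j * Nat.choose (n + j + 2) (j + 3) : ℤ) := by
  obtain ⟨k, rfl⟩ := Nat.exists_eq_add_of_le' hn
  rw [SemiBaxter.semiBaxterCount_succ (k + 1)]
  have h := SemiBaxter.descendants_closed_formula k
  push_cast at h ⊢
  rw [← h]
  ring
end

section
/- Let SB_n denote the number of semi-Baxter permutations of size n. For every n ≥ 2, (n−1)·n²·(n+1)·(n+2)·SB_n = 24·Σ_{j=0}^{n} binomial(n+1, j+3)·binomial(n+2, j+1)·binomial(n+j+3, j). (Theorem 3.13, third formula.) -/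
theorem cast_choose_succ_right (n j : ℕ) :
    (n.choose (j + 1) : ℚ) = n.choose j * (n - j) / (j + 1) := by
  have h := Nat.choose_succ_right_eq n j
  rw [eq_div_iff (by positivity)]
  rcases le_or_gt j n with hj | hj
  · rw [← Nat.cast_sub hj]; exact_mod_cast h
  · simp [Nat.choose_eq_zero_of_lt hj, Nat.choose_eq_zero_of_lt (hj.trans (Nat.lt_succ_self j))]

theorem cast_choose_succ_succ (n j : ℕ) :
    ((n + 1).choose (j + 1) : ℚ) = n.choose j * (n + 1) / (j + 1) := by
  have h := Nat.add_one_mul_choose_eq n j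
  rw [eq_div_iff (by positivity)]
  have : ((n + 1 : ℕ) : ℚ) * n.choose j = (n + 1).choose (j + 1) * ((j + 1 : ℕ) : ℚ) := by
    exact_mod_cast h
  push_cast at this
  linarith

theorem cast_choose_add_succ (m j : ℕ) :
    ((m + j + 1).choose j : ℚ) = (m + j).choose j * (m + j + 1) / (m + 1) := by
  have h := cast_choose_succ_succ (m + j) m
  rw [← Nat.choose_symm_of_eq_add (show m + j = j + m by omega),
    ← Nat.choose_symm_of_eq_add (show m + j + 1 = j + (m + 1) by omega)] at h
  rw [h]
  push_cast
  ring

/-- The summand of the closed formula obtained by Lagrange inversion. -/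
def lagrangeSummand (k j : ℕ) : ℚ :=
  k.choose j * (k.choose (j + 1) * ((k + j + 1).choose (j + 5) + (k + j + 1).choose (j + 4)
      + 2 * (k + j + 1).choose j + 2 * (k + j + 1).choose (k + 2))
    + 2 * k.choose (j + 2) * (-(k + j + 2).choose (j + 5) - (k + j + 2).choose (j + 4)
      + (k + j + 2).choose (j + 3) - (k + j + 2).choose (j + 2) - (k + j + 2).choose (j + 1)
      + (k + j + 2).choose j)
    + 3 * k.choose (j + 3) * ((k + j + 3).choose (j + 4) - (k + j + 3).choose (j + 2)))

/-- The polynomial in the telescoping certificate. -/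
def certPoly (k j : ℚ) : ℚ :=
  (-8 * k ^ 7 - 90 * k ^ 6 - 334 * k ^ 5 - 142 * k ^ 4 + 2254 * k ^ 3 + 5992 * k ^ 2
    + 4712 * k - 576)
  + (-k ^ 7 + 6 * k ^ 6 + 180 * k ^ 5 + 1138 * k ^ 4 + 3265 * k ^ 3 + 4000 * k ^ 2
    - 388 * k - 4368) * j
  + (3 * k ^ 6 + 38 * k ^ 5 + 159 * k ^ 4 + 38 * k ^ 3 - 1544 * k ^ 2 - 4122 * k - 3696) * j ^ 2
  + (-k ^ 5 - 28 * k ^ 4 - 257 * k ^ 3 - 969 * k ^ 2 - 1381 * k - 516) * j ^ 3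
  + (-2 * k ^ 4 - 26 * k ^ 3 - 75 * k ^ 2 + 87 * k + 372) * j ^ 4
  + (11 * k ^ 2 + 77 * k + 132) * j ^ 5
  + (k ^ 2 + 7 * k + 12) * j ^ 6

/-- The antidifference in the telescoping certificate. -/
def certTerm (k j : ℕ) : ℚ :=
  -(((k + 2).choose j * k.choose j * (k + j).choose j : ℚ) * (k - j) * (k + j + 1) * (k + j + 2)
    * j * certPoly k j) / ((k + 2) * (k + 4) * (j + 1) ^ 2 * (j + 2) ^ 2 * (j + 3) * (j + 4))

/-- `lagrangeSummand k j` divided by `(k.choose j) ^ 2 * (k + j).choose j`. -/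
def lagrangeRatio (k j : ℚ) : ℚ :=
  let d₁ := (k + j + 1) / (k + 1)
  let d₂ := d₁ * ((k + j + 2) / (k + 2))
  let d₃ := d₂ * ((k + j + 3) / (k + 3))
  let b₁ := (k - j) / (j + 1)
  let b₂ := b₁ * ((k - j - 1) / (j + 2))
  let b₃ := b₂ * ((k - j - 2) / (j + 3))
  let r := fun n m : ℚ => (n - m) / (j + m + 1)
  b₁ * (d₁ * (r (k + 1) 0 * r (k + 1) 1 * r (k + 1) 2 * r (k + 1) 3 * (r (k + 1) 4 + 1) + 2
      + 2 * (j / (k + 2))))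
    + 2 * b₂ * (d₂ * (r (k + 2) 0 * (r (k + 2) 1 * (r (k + 2) 2 * (-r (k + 2) 3 * r (k + 2) 4
        - r (k + 2) 3 + 1) - 1) - 1) + 1))
    + 3 * b₃ * (d₃ * (r (k + 3) 0 * r (k + 3) 1 * (r (k + 3) 2 * r (k + 3) 3 - 1)))

theorem certRatio_step (k j : ℚ) (hk : 0 ≤ k) (hj : 0 ≤ j) :
    (k + 1) ^ 2 * (k + 2) * (k + 3) *
      ((k + 2 - j) * (k + 1 - j) / ((k + 1) * (k + 2)) * lagrangeRatio k j)
      - 24 * ((k - j) * (k + j + 1) * (k + j + 2) * (k + j + 3) * (k + j + 4)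
        / ((j + 1) ^ 2 * (j + 2) * (j + 3) * (k + 4))) =
    -((k + 2 - j) * (k - j) * (k + j + 1) * (k - j - 1) * (k + j + 2) * (k + j + 3)
        * certPoly k (j + 1)) / ((j + 1) ^ 2 * (k + 2) * (k + 4) * (j + 2) ^ 2 * (j + 3) ^ 2
          * (j + 4) * (j + 5))
      + (k - j) * (k + j + 1) * (k + j + 2) * j * certPoly k j
        / ((k + 2) * (k + 4) * (j + 1) ^ 2 * (j + 2) ^ 2 * (j + 3) * (j + 4)) := by
  unfold lagrangeRatio certPoly
  field_simp
  ring

theorem certTerm_succ (k j : ℕ) :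
    certTerm k (j + 1) = (k + 2).choose j * k.choose j * (k + j).choose j *
      (-((k + 2 - j) * (k - j) * (k + j + 1) * (k - j - 1) * (k + j + 2) * (k + j + 3)
        * certPoly k (j + 1)) / ((j + 1) ^ 2 * (k + 2) * (k + 4) * (j + 2) ^ 2 * (j + 3) ^ 2
          * (j + 4) * (j + 5))) := by
  unfold certTerm
  rw [show k + (j + 1) = k + j + 1 from rfl, cast_choose_succ_succ (k + j) j,
    cast_choose_succ_right (k + 2) j, cast_choose_succ_right k j]
  push_cast
  generalize ((k + 2).choose j : ℚ) = A
  generalize (k.choose j : ℚ) = B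
  generalize ((k + j).choose j : ℚ) = D
  generalize certPoly k (j + 1) = P
  have hk : (0 : ℚ) ≤ k := by positivity
  have hj : (0 : ℚ) ≤ j := by positivity
  generalize (k : ℚ) = k at *
  generalize (j : ℚ) = j at *
  have h1 : j + 1 + 1 = j + 2 := by ring
  have h2 : j + 1 + 2 = j + 3 := by ring
  have h3 : j + 1 + 3 = j + 4 := by ring
  have h4 : j + 1 + 4 = j + 5 := by ring
  rw [h1, h2, h3, h4]
  field_simp
  ring

theorem certTerm_step (k j : ℕ) :
    (k + 1 : ℚ) ^ 2 * (k + 2) * (k + 3) * lagrangeSummand k j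
      - 24 * ((k + 2).choose (j + 3) * (k + 3).choose (j + 1) * (k + j + 4).choose j)
      = certTerm k (j + 1) - certTerm k j := by
  have hA : (k.choose j : ℚ) =
      (k + 2).choose j * ((k + 2 - j) * (k + 1 - j)) / ((k + 1) * (k + 2)) := by
    have h1 := cast_choose_succ_succ (k + 1) j
    have h2 := cast_choose_succ_succ k j
    have h3 := cast_choose_succ_right (k + 2) j
    have h4 := cast_choose_succ_right (k + 1) j
    push_cast at h1 h2 h3 h4
    have h5 : ((k + 1).choose j : ℚ) = (k + 2).choose j * (k + 2 - j) / (k + 2) := by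
      rw [h1] at h3
      field_simp at h3 ⊢
      linarith
    rw [h2, h5] at h4
    field_simp at h4 ⊢
    linarith
  have hB1 := cast_choose_succ_right k j
  have hB2 := cast_choose_succ_right k (j + 1)
  have hB3 := cast_choose_succ_right k (j + 2)
  have hR1 := cast_choose_succ_succ (k + 2) j
  have hR2 := cast_choose_succ_succ (k + 1) (j + 2)
  have hR3 := cast_choose_succ_succ k (j + 1)
  have hD1 := cast_choose_add_succ k j
  have hD2 := cast_choose_add_succ (k + 1) j
  have hD3 := cast_choose_add_succ (k + 2) j
  have hD4 := cast_choose_add_succ (k + 3) j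
  have e1 : k + 1 + j = k + j + 1 := by omega
  have e2 : k + 2 + j = k + j + 2 := by omega
  have e3 : k + 3 + j = k + j + 3 := by omega
  rw [e1] at hD2
  rw [e2] at hD3
  rw [e3] at hD4
  have f := fun i m => cast_choose_succ_right (k + j + i) (j + m)
  have f10 := f 1 0
  have f11 := f 1 1
  have f12 := f 1 2
  have f13 := f 1 3
  have f14 := f 1 4
  have f20 := f 2 0
  have f21 := f 2 1
  have f22 := f 2 2
  have f23 := f 2 3
  have f24 := f 2 4
  have f30 := f 3 0
  have f31 := f 3 1
  have f32 := f 3 2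
  have f33 := f 3 3
  have hS : ((k + j + 1).choose (k + 2) : ℚ) = (k + j).choose j * (k + j + 1) * j
      / ((k + 1) * (k + 2)) := by
    have g1 := cast_choose_succ_right (k + j + 1) (k + 1)
    rw [Nat.choose_symm_of_eq_add (show k + j + 1 = (k + 1) + j by omega), hD1] at g1
    rw [show k + 2 = k + 1 + 1 from rfl, g1]
    push_cast
    field_simp
    ring
  simp only [add_zero, add_assoc j, add_assoc k 1, add_assoc k 2, add_assoc k 3,
    add_assoc (k + j), Nat.reduceAdd] at *
  have hL : lagrangeSummand k j = k.choose j * (k.choose j * (k + j).choose j *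
      lagrangeRatio k j) := by
    unfold lagrangeSummand lagrangeRatio
    rw [hB3, hB2, hB1, f14, f13, f12, f11, f10, f24, f23, f22, f21, f20, f33, f32, f31, f30, hS,
      hD3, hD2, hD1]
    push_cast
    field_simp
    ring
  have hL' : lagrangeSummand k j = (k + 2).choose j * k.choose j * (k + j).choose j *
      ((k + 2 - j) * (k + 1 - j) / ((k + 1) * (k + 2)) * lagrangeRatio k j) := by
    rw [hL]
    nth_rewrite 1 [hA]
    ring
  have hR : ((k + 2).choose (j + 3) * (k + 3).choose (j + 1) * (k + j + 4).choose j : ℚ) =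
      (k + 2).choose j * k.choose j * (k + j).choose j *
      ((k - j) * (k + j + 1) * (k + j + 2) * (k + j + 3) * (k + j + 4)
        / ((j + 1) ^ 2 * (j + 2) * (j + 3) * (k + 4))) := by
    rw [hR2, hR3, hB1, hR1, hD4, hD3, hD2, hD1]
    push_cast
    field_simp
    ring
  rw [hL', hR, certTerm_succ]
  unfold certTerm
  linear_combination ((k + 2).choose j * k.choose j * (k + j).choose j : ℚ) *
    certRatio_step k j (by positivity) (by positivity)

theorem sum_lagrangeSummand (k : ℕ) :
    (k + 1 : ℚ) ^ 2 * (k + 2) * (k + 3) * ∑ j ∈ Finset.range (k + 2), lagrangeSummand k j =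
      24 * ∑ j ∈ Finset.range (k + 2),
        ((k + 2).choose (j + 3) * (k + 3).choose (j + 1) * (k + j + 4).choose j : ℚ) := by
  have h := Finset.sum_congr (rfl : Finset.range (k + 2) = _) fun j _ => certTerm_step k j
  rw [Finset.sum_range_sub, Finset.sum_sub_distrib, ← Finset.mul_sum, ← Finset.mul_sum] at h
  have h0 : certTerm k 0 = 0 := by simp [certTerm]
  have h1 : certTerm k (k + 2) = 0 := by simp [certTerm, Nat.choose_eq_zero_of_lt]
  rw [h0, h1] at h
  linarith

section LagrangeInversion

open PowerSeries

variable {A : Type*} [CommRing A]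

/-- Coefficients of the power series solution of `V = p X (1 + V) (1 + q V)`. -/
def narayanaCoeff (p q : A) : ℕ → A
  | 0 => 0
  | n + 1 => p * ((if n = 0 then 1 else 0) + (1 + q) * narayanaCoeff p q n
      + q * ∑ i : Fin (n + 1), narayanaCoeff p q i * narayanaCoeff p q (n - i))

/-- The power series solution of `V = p X (1 + V) (1 + q V)`. -/
def narayanaSeries (p q : A) : A⟦X⟧ := PowerSeries.mk (narayanaCoeff p q)

theorem narayanaSeries_eq (p q : A) :
    narayanaSeries p q =
      X * (C p * (1 + narayanaSeries p q) * (1 + C q * narayanaSeries p q)) := by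
  have h : C p * (1 + narayanaSeries p q) * (1 + C q * narayanaSeries p q) =
      C p * (1 + C (1 + q) * narayanaSeries p q
        + C q * (narayanaSeries p q * narayanaSeries p q)) := by
    simp only [map_add, map_one]
    ring
  rw [h]
  ext n
  cases n with
  | zero => simp [narayanaSeries, narayanaCoeff]
  | succ n =>
    rw [coeff_succ_X_mul, coeff_C_mul, map_add, map_add, coeff_C_mul, coeff_C_mul, coeff_mul,
      Finset.Nat.sum_antidiagonal_eq_sum_range_succ_mk, Finset.sum_range, coeff_one]
    simp only [narayanaSeries, coeff_mk]
    rw [narayanaCoeff]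

theorem coeff_zero_narayanaSeries (p q : A) : coeff 0 (narayanaSeries p q) = 0 := by
  simp [narayanaSeries, narayanaCoeff]

theorem coeff_succ_narayanaSeries_pow (p q : A) (k i : ℕ) :
    coeff (k + 1) (narayanaSeries p q ^ (i + 1)) =
      p * (coeff k (narayanaSeries p q ^ i) + (1 + q) * coeff k (narayanaSeries p q ^ (i + 1))
        + q * coeff k (narayanaSeries p q ^ (i + 2))) := by
  have h : narayanaSeries p q ^ (i + 1) = X * (C p * (narayanaSeries p q ^ i
      + C (1 + q) * narayanaSeries p q ^ (i + 1) + C q * narayanaSeries p q ^ (i + 2))) := by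
    have := narayanaSeries_eq p q
    simp only [map_add, map_one]
    linear_combination narayanaSeries p q ^ i * this
  conv_lhs => rw [h, coeff_succ_X_mul, coeff_C_mul, map_add, map_add, coeff_C_mul, coeff_C_mul]

/-- The coefficients of the powers of `narayanaSeries`. -/
def narayanaNumber (i k j : ℕ) : ℚ := i * (k.choose j * k.choose (i + j)) / k

theorem narayanaNumber_zero_right (i k : ℕ) (hk : k ≠ 0) :
    narayanaNumber (i + 1) (k + 1) 0 =
      narayanaNumber i k 0 + narayanaNumber (i + 1) k 0 := by
  have hk' : (k : ℚ) ≠ 0 := by exact_mod_cast hk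
  simp only [narayanaNumber, Nat.choose_zero_right, add_zero]
  rw [cast_choose_succ_succ, cast_choose_succ_right]
  push_cast
  field_simp
  ring

theorem narayanaNumber_succ_right (i k j : ℕ) (hk : k ≠ 0) :
    narayanaNumber (i + 1) (k + 1) (j + 1) =
      narayanaNumber i k (j + 1) + narayanaNumber (i + 1) k (j + 1)
        + narayanaNumber (i + 1) k j + narayanaNumber (i + 2) k j := by
  have hk' : (k : ℚ) ≠ 0 := by exact_mod_cast hk
  simp only [narayanaNumber]
  rw [show i + 1 + (j + 1) = i + j + 1 + 1 by ring, show i + (j + 1) = i + j + 1 by ring,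
    show i + 1 + j = i + j + 1 by ring, show i + 2 + j = i + j + 1 + 1 by ring,
    cast_choose_succ_succ k (i + j + 1), cast_choose_succ_succ k j,
    cast_choose_succ_right k (i + j + 1), cast_choose_succ_right k j]
  push_cast
  field_simp
  ring

variable [Algebra ℚ A]

theorem sum_narayanaNumber_succ (q : A) (i k : ℕ) (hk : k ≠ 0) :
    ∑ j ∈ Finset.range (k + 2), algebraMap ℚ A (narayanaNumber (i + 1) (k + 1) j) * q ^ j =
      ∑ j ∈ Finset.range (k + 1), algebraMap ℚ A (narayanaNumber i k j) * q ^ j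
      + (1 + q) * ∑ j ∈ Finset.range (k + 1), algebraMap ℚ A (narayanaNumber (i + 1) k j) * q ^ j
      + q * ∑ j ∈ Finset.range (k + 1), algebraMap ℚ A (narayanaNumber (i + 2) k j) * q ^ j := by
  have ext (i : ℕ) : ∑ j ∈ Finset.range (k + 1), algebraMap ℚ A (narayanaNumber i k j) * q ^ j =
      ∑ j ∈ Finset.range (k + 1), algebraMap ℚ A (narayanaNumber i k (j + 1)) * q ^ (j + 1)
        + algebraMap ℚ A (narayanaNumber i k 0) := by
    have h := Finset.sum_range_succ' (fun j => algebraMap ℚ A (narayanaNumber i k j) * q ^ j) (k + 1)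
    rw [Finset.sum_range_succ] at h
    simpa [narayanaNumber] using h
  rw [Finset.sum_range_succ', add_mul, one_mul, ext i]
  nth_rewrite 1 [ext (i + 1)]
  simp only [narayanaNumber_zero_right i k hk, narayanaNumber_succ_right i k _ hk, map_add,
    add_mul, Finset.sum_add_distrib, Finset.mul_sum, pow_zero, mul_one]
  have e (i : ℕ) : ∑ j ∈ Finset.range (k + 1), q * (algebraMap ℚ A (narayanaNumber i k j) * q ^ j) =
      ∑ j ∈ Finset.range (k + 1), algebraMap ℚ A (narayanaNumber i k j) * q ^ (j + 1) :=
    Finset.sum_congr rfl fun j _ => by ring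
  rw [e, e]
  ring

theorem coeff_narayanaSeries_pow (p q : A) (k i : ℕ) :
    coeff (k + 1) (narayanaSeries p q ^ i) =
      p ^ (k + 1) * ∑ j ∈ Finset.range (k + 2),
        algebraMap ℚ A (narayanaNumber i (k + 1) j) * q ^ j := by
  induction k generalizing i with
  | zero =>
    cases i with
    | zero => simp [narayanaNumber, coeff_one]
    | succ i =>
      rw [coeff_succ_narayanaSeries_pow]
      simp only [coeff_zero_eq_constantCoeff, map_pow]
      rw [← coeff_zero_eq_constantCoeff_apply, coeff_zero_narayanaSeries]
      cases i with
      | zero => simp [Finset.sum_range_succ, narayanaNumber]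
      | succ i =>
        simp [Finset.sum_range_succ, narayanaNumber, Nat.choose_eq_zero_of_lt]
  | succ k ih =>
    cases i with
    | zero => simp [narayanaNumber, coeff_one]
    | succ i =>
      rw [coeff_succ_narayanaSeries_pow, ih, ih, ih, sum_narayanaNumber_succ q i (k + 1) (by simp)]
      ring

end LagrangeInversion

section KernelElimination

variable {R : Type*} [CommRing R]

/-- The explicit series appearing in the kernel method solution, in terms of `a`, `a' = a⁻¹` and
the series `V`. -/
def kernelRhs (x a a' V : R) : R :=
  x * ((1 + a) ^ 2 + (a' ^ 5 + a' ^ 4 + 2 + 2 * a) * ((1 + a) * V)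
    + (-a' ^ 5 - a' ^ 4 + a' ^ 3 - a' ^ 2 - a' + 1) * ((1 + a) * V) ^ 2
    + (a' ^ 4 - a' ^ 2) * ((1 + a) * V) ^ 3)

theorem kernelRhs_eq {x a a' V U G : R} (ha : a * a' = 1) (hU : U * (1 + V) = 1)
    (hG : G * (a + (1 + a) * V) = 1) (hx : x * (1 + a) = a * V * U * G) :
    kernelRhs x a a' V = (1 + a) * (V - a' * V ^ 2 + a' ^ 3 * U * V ^ 3 - a' ^ 4 * U ^ 2 * V ^ 3
      + a' ^ 4 * U ^ 2 * V ^ 2 * G) := by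
  have h : kernelRhs x a a' V = x * (1 + a) * ((1 + a) * (1 + (a' ^ 5 + 2) * V
      + (-a' ^ 5 - a' ^ 4 + a' ^ 3 - a' ^ 2 - a' + 1) * V ^ 2
      + (a' ^ 4 - a' ^ 2) * (1 + a) * V ^ 3)) := by
    rw [kernelRhs]
    linear_combination (-x * (1 + a) * V * a' ^ 4) * ha
  rw [h, hx]
  have key : a * (1 + V) * (1 + (a' ^ 5 + 2) * V
      + (-a' ^ 5 - a' ^ 4 + a' ^ 3 - a' ^ 2 - a' + 1) * V ^ 2
      + (a' ^ 4 - a' ^ 2) * (1 + a) * V ^ 3) = (1 + V) ^ 2 * (a + (1 + a) * V) * (1 - a' * V)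
      + a' ^ 3 * V ^ 2 * (1 + V) * (a + (1 + a) * V) - a' ^ 4 * V ^ 2 * (a + (1 + a) * V)
      + a' ^ 4 * V := by
    grind
  generalize (1 + (a' ^ 5 + 2) * V
      + (-a' ^ 5 - a' ^ 4 + a' ^ 3 - a' ^ 2 - a' + 1) * V ^ 2
      + (a' ^ 4 - a' ^ 2) * (1 + a) * V ^ 3) = Q at *
  have hQ : a * U * G * Q =
      1 - a' * V + a' ^ 3 * U * V ^ 2 - a' ^ 4 * U ^ 2 * V ^ 2 + a' ^ 4 * U ^ 2 * V * G := by
    calc a * U * G * Q = a * U * G * Q * (U * (1 + V)) := by rw [hU, mul_one]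
      _ = U ^ 2 * G * (a * (1 + V) * Q) := by ring
      _ = (U * (1 + V)) ^ 2 * (G * (a + (1 + a) * V)) * (1 - a' * V)
          + U * (U * (1 + V)) * (G * (a + (1 + a) * V)) * (a' ^ 3 * V ^ 2)
          - U ^ 2 * (G * (a + (1 + a) * V)) * (a' ^ 4 * V ^ 2) + a' ^ 4 * U ^ 2 * V * G := by
        rw [key]
        ring
      _ = _ := by
        rw [hU, hG]
        ring
  linear_combination (1 + a) * V * hQ

theorem kernel_elimination {x a a' V U G e₁ e₂ e₃ d₁ d₂ d₃ : R} (ha : a * a' = 1)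
    (hU : U * (1 + V) = 1) (hG : G * (a + (1 + a) * V) = 1)
    (hV : V = x * a' * (1 + a) * (1 + V) * (a + (1 + a) * V))
    (h₁ : (1 + a) * V * e₁ + a * d₁ = a * ((1 + a) * V))
    (h₂ : a * (1 + V) * e₁ + V * d₂ = V * (a * (1 + V)))
    (h₃ : V * a' * e₂ + V * d₂ = V * (V * a'))
    (h₄ : V * (a + (1 + a) * V) * e₂ + V * d₃ = V * (V * a' * U * (a + (1 + a) * V)))
    (h₅ : e₃ + V * d₃ = V * a' * U) :
    d₁ + (1 + a) ^ 2 * a' ^ 4 * x * e₃ = kernelRhs x a a' V := by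
  have hx : x * (1 + a) = a * V * U * G := by
    calc x * (1 + a) = x * (1 + a) * (a * a') * (U * (1 + V)) * (G * (a + (1 + a) * V)) := by
          rw [ha, hU, hG]
          ring
      _ = a * V * U * G := by linear_combination -a * U * G * hV
  rw [kernelRhs_eq ha hU hG hx]
  have h₅' : V * d₃ = V * a' * U - e₃ := by linear_combination h₅
  have h₄' : V * e₂ = V ^ 2 * a' * U - G * (V * a' * U - e₃) := by
    linear_combination G * h₄ - G * h₅' - (V * e₂ - V ^ 2 * a' * U) * hG
  have h₃' : V * d₂ = V ^ 2 * a' - a' * (V * e₂) := by linear_combination h₃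
  have h₂' : e₁ = V - a' * U * (V * d₂) := by
    linear_combination a' * U * h₂ - (e₁ - V) * (a * a' * hU + ha)
  have h₁' : d₁ = (1 + a) * V - a' * (1 + a) * V * e₁ := by
    linear_combination a' * h₁ - (d₁ - (1 + a) * V) * ha
  rw [h₁', h₂', h₃', h₄']
  linear_combination (1 + a) * a' ^ 4 * e₃ * hx + (1 + a) * a' ^ 3 * V * U * G * e₃ * ha

end KernelElimination

section GeneratingTree

/-- The permutation obtained from `π` by appending the value `a` and shifting larger values. -/
def appendPerm {n : ℕ} (π : Equiv.Perm (Fin n)) (a : Fin (n + 1)) : Equiv.Perm (Fin (n + 1)) :=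
  (finSuccEquivLast.trans π.optionCongr).trans (finSuccEquiv' a).symm

theorem appendPerm_castSucc {n : ℕ} (π : Equiv.Perm (Fin n)) (a : Fin (n + 1)) (i : Fin n) :
    appendPerm π a i.castSucc = a.succAbove (π i) := by
  simp [appendPerm]

theorem appendPerm_last {n : ℕ} (π : Equiv.Perm (Fin n)) (a : Fin (n + 1)) :
    appendPerm π a (Fin.last n) = a := by
  simp [appendPerm]

theorem appendPerm_bijective (n : ℕ) :
    Function.Bijective fun p : Equiv.Perm (Fin n) × Fin (n + 1) => appendPerm p.1 p.2 := by
  rw [Fintype.bijective_iff_injective_and_card]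
  constructor
  · rintro ⟨π, a⟩ ⟨ρ, b⟩ h
    have h' : appendPerm π a = appendPerm ρ b := h
    have hab : a = b := by
      rw [← appendPerm_last π a, h', appendPerm_last]
    subst hab
    congr 1
    ext i : 1
    apply a.succAbove_right_injective
    rw [← appendPerm_castSucc, h', appendPerm_castSucc]
  · simp [Fintype.card_perm, Nat.factorial_succ, mul_comm]

theorem val_succAbove {n : ℕ} (a : Fin (n + 1)) (i : Fin n) :
    (a.succAbove i : ℕ) = if (i : ℕ) < a then (i : ℕ) else i + 1 := by
  rw [Fin.succAbove]
  simp only [Fin.lt_def, Fin.val_castSucc]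
  split_ifs <;> simp

/-- The site `b` of `π` is active: appending the value `b` creates no occurrence of 2-41-3. -/
def Active {n : ℕ} (π : Equiv.Perm (Fin n)) (b : ℕ) : Prop :=
  ∀ i j j' : Fin n, (i : ℕ) < j → (j' : ℕ) = j + 1 → (π j' : ℕ) < π i → (π i : ℕ) < b →
    b ≤ (π j : ℕ) → False

theorem isSemiBaxter_appendPerm {n : ℕ} (π : Equiv.Perm (Fin n)) (a : Fin (n + 1)) :
    IsSemiBaxter (appendPerm π a) ↔ IsSemiBaxter π ∧ Active π a := by
  constructor
  · intro h
    refine ⟨fun ⟨i, j, j', k, h1, h2, h3, h4, h5, h6⟩ => h ⟨i.castSucc, j.castSucc, j'.castSucc,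
      k.castSucc, by simpa using h1, by simpa using h2, by simpa using h3, ?_, ?_, ?_⟩,
      fun i j j' h1 h2 h3 h4 h5 => h ⟨i.castSucc, j.castSucc, j'.castSucc,
      Fin.last n, by simpa using h1, by simpa using h2, by simp, ?_, ?_, ?_⟩⟩
    · simpa [appendPerm_castSucc] using h4
    · simpa [appendPerm_castSucc] using h5
    · simpa [appendPerm_castSucc] using h6
    · simpa [appendPerm_castSucc] using h3
    · rw [Fin.lt_def, appendPerm_castSucc, appendPerm_last, val_succAbove, if_pos h4]
      exact h4
    · rw [Fin.lt_def, appendPerm_castSucc, appendPerm_last, val_succAbove, if_neg (by omega)]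
      omega
  · rintro ⟨h, ha⟩ ⟨i, j, j', k, h1, h2, h3, h4, h5, h6⟩
    induction i using Fin.lastCases with
    | last => simp at h1; omega
    | cast i =>
    induction j using Fin.lastCases with
    | last => simp at h2; omega
    | cast j =>
    induction j' using Fin.lastCases with
    | last => simp at h3; omega
    | cast j' =>
    simp only [Fin.val_castSucc] at h1 h2 h3
    induction k using Fin.lastCases with
    | last =>
      simp only [appendPerm_castSucc, appendPerm_last, Fin.lt_def, val_succAbove] at h4 h5 h6
      refine ha i j j' h1 h2 ?_ ?_ ?_ <;> split_ifs at h4 h5 h6 <;> omega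
    | cast k =>
      simp only [appendPerm_castSucc, Fin.succAbove_lt_succAbove_iff] at h4 h5 h6
      exact h ⟨i, j, j', k, h1, h2, h3, h4, h5, h6⟩

theorem active_appendPerm {n : ℕ} (π : Equiv.Perm (Fin (n + 1))) (a : Fin (n + 2)) (b : ℕ) :
    Active (appendPerm π a) b ↔ Active π (if b ≤ a then b else b - 1) ∧
      ¬((a : ℕ) ≤ π (Fin.last n) ∧ (a : ℕ) + 1 < b ∧ b ≤ π (Fin.last n) + 1) := by
  constructor
  · intro h
    refine ⟨fun i j j' h1 h2 h3 h4 h5 => h i.castSucc j.castSucc j'.castSucc (by simpa using h1)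
      (by simpa using h2) ?_ ?_ ?_, fun ⟨h1, h2, h3⟩ => ?_⟩
    · simpa [appendPerm_castSucc] using h3
    · rw [appendPerm_castSucc, val_succAbove]
      split_ifs at h4 ⊢ <;> omega
    · rw [appendPerm_castSucc, val_succAbove]
      split_ifs at h5 ⊢ <;> omega
    · have hl := (π (Fin.last n)).isLt
      obtain ⟨i, hi⟩ := π.surjective ⟨a, by omega⟩
      have hi' : i ≠ Fin.last n := by
        rintro rfl
        rw [hi] at h3
        simp at h3
        omega
      refine h i.castSucc (Fin.last n).castSucc (Fin.last (n + 1)) ?_ ?_ ?_ ?_ ?_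
      · simpa [Fin.lt_def] using Fin.lt_last_iff_ne_last.mpr hi'
      · simp
      · rw [appendPerm_castSucc, appendPerm_last, val_succAbove, hi]
        simp
      · rw [appendPerm_castSucc, val_succAbove, hi]
        simpa using h2
      · rw [appendPerm_castSucc, val_succAbove, if_neg (by omega)]
        omega
  · rintro ⟨h, hn⟩ i j j' h1 h2 h3 h4 h5
    induction i using Fin.lastCases with
    | last => simp at h1; omega
    | cast i =>
    induction j using Fin.lastCases with
    | last => simp at h2; omega
    | cast j =>
    simp only [Fin.val_castSucc] at h1 h2
    induction j' using Fin.lastCases with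
    | last =>
      have hj : j = Fin.last n := by
        ext
        simp at h2 ⊢
        omega
      subst hj
      simp only [appendPerm_castSucc, appendPerm_last, val_succAbove] at h3 h4 h5
      apply hn
      split_ifs at h3 h4 h5 <;> omega
    | cast j' =>
      simp only [appendPerm_castSucc, val_succAbove, Fin.val_castSucc] at h2 h3 h4 h5
      refine h i j j' h1 h2 ?_ ?_ ?_ <;> split_ifs at h3 h4 h5 ⊢ <;> omega

open Classical in
/-- The active sites of `π` that are not above its last value. -/
noncomputable def lowSites {n : ℕ} (π : Equiv.Perm (Fin (n + 1))) : Finset ℕ :=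
  {b ∈ Finset.range (n + 2) | Active π b ∧ b ≤ π (Fin.last n)}

open Classical in
/-- The active sites of `π` that are above its last value. -/
noncomputable def highSites {n : ℕ} (π : Equiv.Perm (Fin (n + 1))) : Finset ℕ :=
  {b ∈ Finset.range (n + 2) | Active π b ∧ (π (Fin.last n) : ℕ) < b}

theorem lowSites_appendPerm_of_mem_low {n : ℕ} {π : Equiv.Perm (Fin (n + 1))} {a : Fin (n + 2)}
    (ha : (a : ℕ) ∈ lowSites π) :
    (lowSites (appendPerm π a)).card = {b ∈ lowSites π | b ≤ (a : ℕ)}.card := by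
  congr 1
  ext b
  have := a.isLt
  simp only [lowSites, Finset.mem_filter, Finset.mem_range, active_appendPerm,
    appendPerm_last] at ha ⊢
  constructor
  · rintro ⟨h1, ⟨h2, h3⟩, h4⟩
    rw [if_pos h4] at h2
    exact ⟨⟨by omega, h2, by omega⟩, h4⟩
  · rintro ⟨⟨h1, h2, h3⟩, h4⟩
    rw [if_pos h4]
    exact ⟨by omega, ⟨h2, by omega⟩, h4⟩

theorem lowSites_appendPerm_of_mem_high {n : ℕ} {π : Equiv.Perm (Fin (n + 1))} {a : Fin (n + 2)}
    (ha : (a : ℕ) ∈ highSites π) :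
    (lowSites (appendPerm π a)).card =
      (lowSites π).card + {b ∈ highSites π | b ≤ (a : ℕ)}.card := by
  rw [← Finset.card_union_of_disjoint]
  · congr 1
    ext b
    have := a.isLt
    simp only [lowSites, highSites, Finset.mem_filter, Finset.mem_range, active_appendPerm,
      appendPerm_last, Finset.mem_union] at ha ⊢
    constructor
    · rintro ⟨h1, ⟨h2, h3⟩, h4⟩
      rw [if_pos h4] at h2
      rcases le_or_gt b (π (Fin.last n) : ℕ) with h | h
      · exact Or.inl ⟨by omega, h2, h⟩
      · exact Or.inr ⟨⟨by omega, h2, h⟩, h4⟩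
    · rintro (⟨h1, h2, h3⟩ | ⟨⟨h1, h2, h3⟩, h4⟩)
      · rw [if_pos (by omega)]
        exact ⟨by omega, ⟨h2, by omega⟩, by omega⟩
      · rw [if_pos h4]
        exact ⟨by omega, ⟨h2, by omega⟩, h4⟩
  · rw [Finset.disjoint_left]
    simp only [lowSites, highSites, Finset.mem_filter]
    omega

theorem highSites_appendPerm_of_mem_low {n : ℕ} {π : Equiv.Perm (Fin (n + 1))} {a : Fin (n + 2)}
    (ha : (a : ℕ) ∈ lowSites π) :
    (highSites (appendPerm π a)).card = (highSites π).card + 1 := by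
  classical
  have h : highSites (appendPerm π a) = insert ((a : ℕ) + 1) ((highSites π).image (· + 1)) := by
    ext b
    have := a.isLt
    simp only [lowSites, highSites, Finset.mem_filter, Finset.mem_range, active_appendPerm,
      appendPerm_last, Finset.mem_insert, Finset.mem_image] at ha ⊢
    constructor
    · rintro ⟨h1, ⟨h2, h3⟩, h4⟩
      rw [if_neg (by omega)] at h2
      rcases eq_or_ne b (a + 1) with h | h
      · exact Or.inl h
      · exact Or.inr ⟨b - 1, ⟨by omega, h2, by omega⟩, by omega⟩
    · rintro (rfl | ⟨c, ⟨h1, h2, h3⟩, rfl⟩)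
      · rw [if_neg (by omega)]
        exact ⟨by omega, ⟨ha.2.1, by omega⟩, by omega⟩
      · rw [if_neg (by omega)]
        exact ⟨by omega, ⟨h2, by omega⟩, by omega⟩
  rw [h, Finset.card_insert_of_notMem, Finset.card_image_of_injective _ (add_left_injective 1)]
  simp only [lowSites, highSites, Finset.mem_filter, Finset.mem_image] at ha ⊢
  rintro ⟨c, ⟨-, -, h⟩, h'⟩
  omega

theorem highSites_appendPerm_of_mem_high {n : ℕ} {π : Equiv.Perm (Fin (n + 1))} {a : Fin (n + 2)}
    (ha : (a : ℕ) ∈ highSites π) :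
    (highSites (appendPerm π a)).card + {b ∈ highSites π | b ≤ (a : ℕ)}.card =
      (highSites π).card + 1 := by
  classical
  have h : highSites (appendPerm π a) = {c ∈ highSites π | (a : ℕ) ≤ c}.image (· + 1) := by
    ext b
    have := a.isLt
    simp only [highSites, Finset.mem_filter, Finset.mem_range, active_appendPerm,
      appendPerm_last, Finset.mem_image] at ha ⊢
    constructor
    · rintro ⟨h1, ⟨h2, h3⟩, h4⟩
      rw [if_neg (by omega)] at h2
      exact ⟨b - 1, ⟨⟨by omega, h2, by omega⟩, by omega⟩, by omega⟩
    · rintro ⟨c, ⟨⟨h1, h2, h3⟩, h4⟩, rfl⟩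
      rw [if_neg (by omega)]
      exact ⟨by omega, ⟨h2, by omega⟩, by omega⟩
  rw [h, Finset.card_image_of_injective _ (add_left_injective 1), ← Finset.card_union_add_card_inter,
    ← Finset.filter_or, ← Finset.filter_and]
  congr 1
  · rw [Finset.filter_true_of_mem fun c _ => le_total _ _]
  · rw [Finset.card_eq_one]
    refine ⟨a, ?_⟩
    ext c
    simp only [Finset.mem_filter, Finset.mem_singleton]
    constructor
    · rintro ⟨-, h1, h2⟩
      omega
    · rintro rfl
      exact ⟨ha, le_rfl, le_rfl⟩

theorem sum_rank {M : Type*} [AddCommMonoid M] (s : Finset ℕ) (f : ℕ → M) :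
    ∑ a ∈ s, f {b ∈ s | b ≤ a}.card = ∑ r ∈ Finset.range s.card, f (r + 1) := by
  induction s using Finset.induction_on_max with
  | empty => simp
  | insert m s hm ih =>
    have hms : m ∉ s := fun h => lt_irrefl _ (hm m h)
    rw [Finset.sum_insert hms, Finset.card_insert_of_notMem hms, Finset.sum_range_succ, ← ih,
      add_comm]
    congr 1
    · refine Finset.sum_congr rfl fun a ha => ?_
      rw [Finset.filter_insert, if_neg (not_le.mpr (hm a ha))]
    · rw [Finset.filter_true_of_mem, Finset.card_insert_of_notMem hms]
      intro b hb
      rcases Finset.mem_insert.mp hb with rfl | hb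
      · exact le_rfl
      · exact (hm b hb).le

variable {R : Type*} [CommRing R]

open Classical in
/-- The generating polynomial of semi-Baxter permutations of size `n + 1` by the numbers of active
sites below and above the last value. -/
noncomputable def siteSum (n : ℕ) (y z : R) : R :=
  ∑ π : Equiv.Perm (Fin (n + 1)) with IsSemiBaxter π,
    y ^ (lowSites π).card * z ^ (highSites π).card

theorem siteSum_zero (y z : R) : siteSum 0 y z = y * z := by
  classical
  have hs (π : Equiv.Perm (Fin 1)) : IsSemiBaxter π := by
    rintro ⟨i, j, -, -, h, -⟩
    omega
  have ha (π : Equiv.Perm (Fin 1)) (b : ℕ) : Active π b := fun i j _ h => by omega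
  have hl (π : Equiv.Perm (Fin 1)) : lowSites π = {0} := by
    ext b
    simp [lowSites, ha]
  have hh (π : Equiv.Perm (Fin 1)) : highSites π = {1} := by
    ext b
    simp [highSites, ha]
    omega
  simp [siteSum, hs, hl, hh]

open Classical in
theorem sum_active {n : ℕ} (π : Equiv.Perm (Fin (n + 1))) (f : ℕ → R) :
    ∑ a ∈ Finset.univ.filter fun a : Fin (n + 2) => Active π a, f a = ∑ a ∈ lowSites π, f a + ∑ a ∈ highSites π, f a := by
  rw [← Finset.sum_union]
  · rw [Finset.sum_filter, Fin.sum_univ_eq_sum_range fun a => if Active π a then f a else 0,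
      ← Finset.sum_filter]
    refine Finset.sum_congr ?_ fun _ _ => rfl
    ext b
    simp only [lowSites, highSites, Finset.mem_filter, Finset.mem_union, Finset.mem_range]
    have := le_or_gt b (π (Fin.last n) : ℕ)
    tauto
  · rw [Finset.disjoint_left]
    simp only [lowSites, highSites, Finset.mem_filter]
    omega

open Classical in
theorem sum_children {n : ℕ} (π : Equiv.Perm (Fin (n + 1))) (y z : R) :
    ∑ a ∈ Finset.univ.filter fun a : Fin (n + 2) => Active π a,
      y ^ (lowSites (appendPerm π a)).card * z ^ (highSites (appendPerm π a)).card =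
    y * z * (z ^ (highSites π).card * ∑ r ∈ Finset.range (lowSites π).card, y ^ r
      + y ^ (lowSites π).card * ∑ r ∈ Finset.range (highSites π).card,
          y ^ r * z ^ ((highSites π).card - 1 - r)) := by
  have h (a : Fin (n + 2)) (ha : Active π a) :
      y ^ (lowSites (appendPerm π a)).card * z ^ (highSites (appendPerm π a)).card =
      if (a : ℕ) ≤ π (Fin.last n) then
        y ^ {b ∈ lowSites π | b ≤ (a : ℕ)}.card * z ^ ((highSites π).card + 1)
      else y ^ ((lowSites π).card + {b ∈ highSites π | b ≤ (a : ℕ)}.card) *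
        z ^ ((highSites π).card + 1 - {b ∈ highSites π | b ≤ (a : ℕ)}.card) := by
    have := a.isLt
    split_ifs with hl
    · have hm : (a : ℕ) ∈ lowSites π := by
        simp only [lowSites, Finset.mem_filter, Finset.mem_range]
        exact ⟨a.isLt, ha, hl⟩
      rw [lowSites_appendPerm_of_mem_low hm, highSites_appendPerm_of_mem_low hm]
    · have hm : (a : ℕ) ∈ highSites π := by
        simp only [highSites, Finset.mem_filter, Finset.mem_range]
        exact ⟨a.isLt, ha, by omega⟩
      rw [lowSites_appendPerm_of_mem_high hm, ← highSites_appendPerm_of_mem_high hm,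
        Nat.add_sub_cancel]
  rw [Finset.sum_congr rfl fun a ha => h a (Finset.mem_filter.mp ha).2,
    sum_active π fun a => if a ≤ π (Fin.last n) then
        y ^ {b ∈ lowSites π | b ≤ a}.card * z ^ ((highSites π).card + 1)
      else y ^ ((lowSites π).card + {b ∈ highSites π | b ≤ a}.card) *
        z ^ ((highSites π).card + 1 - {b ∈ highSites π | b ≤ a}.card)]
  rw [Finset.sum_congr rfl fun a ha => if_pos (Finset.mem_filter.mp ha).2.2,
    Finset.sum_congr (rfl : highSites π = _)
      fun a ha => if_neg (not_le.mpr (Finset.mem_filter.mp ha).2.2),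
    sum_rank (lowSites π) fun r => y ^ r * z ^ ((highSites π).card + 1),
    sum_rank (highSites π) fun r => y ^ ((lowSites π).card + r) * z ^ ((highSites π).card + 1 - r),
    mul_add, Finset.mul_sum, Finset.mul_sum, Finset.mul_sum, Finset.mul_sum]
  congr 1
  · exact Finset.sum_congr rfl fun r _ => by ring
  · refine Finset.sum_congr rfl fun r hr => ?_
    have hr' := Finset.mem_range.mp hr
    rw [show (highSites π).card + 1 - (r + 1) = ((highSites π).card - 1 - r) + 1 by omega]
    ring

theorem siteSum_succ (n : ℕ) (y z : R) :
    ∃ Q : R, siteSum (n + 1) y z = y * z * Q ∧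
      (1 - y) * (z - y) * Q = (z - y) * (siteSum n 1 z - siteSum n y z)
        + (1 - y) * (siteSum n y z - siteSum n y y) := by
  classical
  refine ⟨∑ π : Equiv.Perm (Fin (n + 1)) with IsSemiBaxter π,
    (z ^ (highSites π).card * ∑ r ∈ Finset.range (lowSites π).card, y ^ r
      + y ^ (lowSites π).card * ∑ r ∈ Finset.range (highSites π).card,
          y ^ r * z ^ ((highSites π).card - 1 - r)), ?_, ?_⟩
  · rw [Finset.mul_sum, siteSum, Finset.sum_filter,
      ← (appendPerm_bijective (n + 1)).sum_comp, Fintype.sum_prod_type, Finset.sum_filter]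
    refine Finset.sum_congr rfl fun π _ => ?_
    simp only [isSemiBaxter_appendPerm]
    split_ifs with h
    · simp only [h, true_and]
      rw [← Finset.sum_filter, ← sum_children]
    · simp [h]
  · simp only [siteSum, one_pow, one_mul]
    rw [Finset.mul_sum, ← Finset.sum_sub_distrib, ← Finset.sum_sub_distrib, Finset.mul_sum,
      Finset.mul_sum, ← Finset.sum_add_distrib]
    refine Finset.sum_congr rfl fun π _ => ?_
    have h1 := mul_neg_geom_sum y (lowSites π).card
    have h2 := geom_sum₂_mul y z (highSites π).card
    linear_combination (z - y) * z ^ (highSites π).card * h1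
      - (1 - y) * y ^ (lowSites π).card * h2

theorem siteSum_one_one (n : ℕ) : siteSum n (1 : R) 1 = semiBaxterCount (n + 1) := by
  classical
  simp [siteSum, semiBaxterCount, Nat.card_eq_fintype_card, Fintype.card_subtype]

theorem map_siteSum {S : Type*} [CommRing S] (φ : R →+* S) (n : ℕ) (y z : R) :
    φ (siteSum n y z) = siteSum n (φ y) (φ z) := by
  simp [siteSum]

end GeneratingTree

section KernelSolution

variable {R : Type*} [CommRing R]

/-- The truncated series `∑ x ^ (m + 1) * siteSum m y z`. -/
noncomputable def siteSeries (N : ℕ) (x y z : R) : R :=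
  ∑ m ∈ Finset.range N, x ^ (m + 1) * siteSum m y z

theorem map_siteSeries {S : Type*} [CommRing S] (φ : R →+* S) (N : ℕ) (x y z : R) :
    φ (siteSeries N x y z) = siteSeries N (φ x) (φ y) (φ z) := by
  simp [siteSeries, map_siteSum]

theorem siteSeries_kernel {N : ℕ} {b c d x : R} (hx : x ^ (N + 1) = 0) (hd : c - b = d)
    (h : b * d = x * (1 + b) * (1 + c) * c) :
    d * siteSeries N x 1 (1 + c) + b * siteSeries N x (1 + b) (1 + b) = b * d := by
  subst hd
  have key (m : ℕ) : x ^ (m + 1) * ((c - b) * siteSum m 1 (1 + c)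
      + b * siteSum m (1 + b) (1 + b)) =
      c * (x ^ (m + 1) * siteSum m (1 + b) (1 + c))
        - c * (x ^ (m + 1 + 1) * siteSum (m + 1) (1 + b) (1 + c)) := by
    obtain ⟨Q, h1, h2⟩ := siteSum_succ m (1 + b) (1 + c)
    rw [h1]
    linear_combination -x ^ (m + 1) * h2 - x ^ (m + 1) * Q * h
  have hs := Finset.sum_range_sub' (fun m => c * (x ^ (m + 1) * siteSum m (1 + b) (1 + c))) N
  simp only [← key, hx, siteSum_zero] at hs
  calc _ = ∑ m ∈ Finset.range N, x ^ (m + 1) * ((c - b) * siteSum m 1 (1 + c)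
        + b * siteSum m (1 + b) (1 + b)) := by
        rw [siteSeries, siteSeries, Finset.mul_sum, Finset.mul_sum, ← Finset.sum_add_distrib]
        exact Finset.sum_congr rfl fun m _ => by ring
    _ = _ := by
      rw [hs]
      linear_combination -h

theorem siteSeries_eq_kernelRhs {N : ℕ} {x a a' V U G : R} (hx : x ^ (N + 1) = 0)
    (ha : a * a' = 1) (hU : U * (1 + V) = 1) (hG : G * (a + (1 + a) * V) = 1)
    (hV : V = x * a' * (1 + a) * (1 + V) * (a + (1 + a) * V)) :
    siteSeries N x (1 + a) (1 + a) + (1 + a) ^ 2 * a' ^ 4 * x * siteSeries N x 1 (1 + a') =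
      kernelRhs x a a' V := by
  have hVU : V * U = x * a' * (1 + a) * (a + (1 + a) * V) := by
    linear_combination U * hV + x * a' * (1 + a) * (a + (1 + a) * V) * hU
  have h₁ := siteSeries_kernel (b := a) (c := a + (1 + a) * V) (d := (1 + a) * V) hx (by ring)
    (by linear_combination a * (1 + a) * hV
      + x * (1 + a) ^ 2 * (1 + V) * (a + (1 + a) * V) * ha)
  have h₂ := siteSeries_kernel (b := V) (c := a + (1 + a) * V) (d := a * (1 + V)) hx (by ring)
    (by linear_combination a * (1 + V) * hV
      + x * (1 + a) * (1 + V) ^ 2 * (a + (1 + a) * V) * ha)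
  have h₃ := siteSeries_kernel (b := V) (c := (1 + a) * V * a') (d := V * a') hx
    (by linear_combination V * ha)
    (by linear_combination V * a' * hV + x * (1 + V) * (1 + a) * V * a' * ha)
  have h6 : 1 + V * U * a' = U * a' * (a + (1 + a) * V) := by
    linear_combination -hU - U * (1 + V) * ha
  have h₄ := siteSeries_kernel (b := V * U * a') (c := (1 + a) * V * a')
    (d := a' * U * V * (a + (1 + a) * V)) hx
    (by linear_combination -V * a' * (1 + a) * hU)
    (by
      have h7 : 1 + (1 + a) * V * a' = a' * (a + (1 + a) * V) := by
        linear_combination -ha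
      rw [h6, h7]
      linear_combination V * U * a' ^ 2 * (a + (1 + a) * V) * hVU)
  have h₅ := siteSeries_kernel (b := V * U * a') (c := a') (d := a' * U) hx
    (by linear_combination -a' * hU)
    (by
      have h7 : 1 + a' = a' * (1 + a) := by
        linear_combination -ha
      rw [h6, h7]
      linear_combination a' ^ 2 * U * hVU)
  have hc : a * (1 + V) * (a' * U) = 1 := by
    linear_combination U * (1 + V) * ha + hU
  refine kernel_elimination ha hU hG hV h₁ h₂ h₃ ?_ ?_
      (e₂ := siteSeries N x 1 (1 + (1 + a) * V * a'))
      (d₃ := siteSeries N x (1 + V * U * a') (1 + V * U * a'))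
  · linear_combination a * (1 + V) * h₄ - (V * (a + (1 + a) * V)
      * siteSeries N x 1 (1 + (1 + a) * V * a') + V * siteSeries N x (1 + V * U * a') (1 + V * U * a')
      - V * (V * a' * U * (a + (1 + a) * V))) * hc
  · linear_combination a * (1 + V) * h₅ - (siteSeries N x 1 (1 + a')
      + V * siteSeries N x (1 + V * U * a') (1 + V * U * a') - V * a' * U) * hc

end KernelSolution

section CoefficientExtraction

open PowerSeries LaurentPolynomial

/-- The constant term of a Laurent polynomial. -/
noncomputable def constantTerm : ℚ[T;T⁻¹] →ₗ[ℚ] ℚ :=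
  Finsupp.lapply 0 ∘ₗ (AddMonoidAlgebra.coeffLinearEquiv ℚ).toLinearMap

theorem constantTerm_apply (p : ℚ[T;T⁻¹]) : constantTerm p = p.coeff 0 := rfl

theorem constantTerm_toLaurent (p : Polynomial ℚ) :
    constantTerm (Polynomial.toLaurent p) = p.coeff 0 := by
  induction p using Polynomial.induction_on' with
  | add p q hp hq => simp [hp, hq]
  | monomial n c =>
    rw [← Polynomial.C_mul_X_pow_eq_monomial, Polynomial.toLaurent_C_mul_X_pow,
      ← LaurentPolynomial.smul_eq_C_mul, map_smul, constantTerm_apply, T_apply,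
      Polynomial.coeff_C_mul_X_pow]
    simp [eq_comm]

theorem constantTerm_invert (p : ℚ[T;T⁻¹]) : constantTerm (invert p) = constantTerm p := by
  simp [constantTerm_apply]

theorem constantTerm_T_neg_mul_pow (r m : ℕ) :
    constantTerm (T (-r) * (1 + T 1) ^ m) = m.choose r := by
  rw [add_comm, add_pow, Finset.mul_sum, map_sum]
  have h (i : ℕ) : constantTerm (T (-r) * (T 1 ^ i * 1 ^ (m - i) * (m.choose i : ℚ[T;T⁻¹]))) =
      if r = i then (m.choose r : ℚ) else 0 := by
    rw [one_pow, mul_one, ← mul_assoc, T_pow, ← T_add, mul_comm, ← nsmul_eq_mul, map_nsmul,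
      constantTerm_apply, T_apply]
    have : (-(r : ℤ) + i * 1 = 0) ↔ r = i := by omega
    simp only [this]
    split_ifs with hi
    · simp [hi]
    · simp
  simp only [h, Finset.sum_ite_eq, Finset.mem_range]
  split_ifs with hr
  · rfl
  · rw [Nat.choose_eq_zero_of_lt (by omega), Nat.cast_zero]

theorem constantTerm_T_mul_pow_of_pos (s m : ℕ) (hs : 0 < s) :
    constantTerm (T s * (1 + T 1) ^ m) = 0 := by
  have h : (T s * (1 + T 1) ^ m : ℚ[T;T⁻¹]) =
      Polynomial.toLaurent (Polynomial.X ^ s * (1 + Polynomial.X) ^ m) := by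
    simp
  rw [h, constantTerm_toLaurent, Polynomial.mul_coeff_zero]
  simp [hs.ne]

theorem constantTerm_siteSum (k : ℕ) :
    constantTerm (siteSum k (1 + T 1) (1 + T 1)) = semiBaxterCount (k + 1) := by
  have h : (siteSum k (1 + T 1) (1 + T 1) : ℚ[T;T⁻¹]) =
      Polynomial.toLaurent (siteSum k (1 + Polynomial.X) (1 + Polynomial.X)) := by
    simp [map_siteSum]
  rw [h, constantTerm_toLaurent, Polynomial.coeff_zero_eq_eval_zero, ← Polynomial.coe_evalRingHom,
    map_siteSum]
  simp [siteSum_one_one]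

theorem constantTerm_mul_siteSum (k : ℕ) :
    constantTerm ((1 + T 1) ^ 2 * T (-1) ^ 4 * siteSum k 1 (1 + T (-1))) = 0 := by
  have h : ((1 + T 1) ^ 2 * T (-1) ^ 4 * siteSum k 1 (1 + T (-1)) : ℚ[T;T⁻¹]) =
      invert (Polynomial.toLaurent
        (Polynomial.X ^ 2 * (1 + Polynomial.X) ^ 2 * siteSum k 1 (1 + Polynomial.X))) := by
    have h1 : (T 1 * T (-1) : ℚ[T;T⁻¹]) = 1 := by
      rw [← T_add]
      simp
    have h2 : invert (siteSum k 1 (1 + T 1) : ℚ[T;T⁻¹]) = siteSum k 1 (1 + T (-1)) := by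
      have := map_siteSum (invert (R := ℚ) : ℚ[T;T⁻¹] →+* ℚ[T;T⁻¹]) k 1 (1 + T 1)
      rwa [map_one, map_add, map_one, RingHom.coe_coe, invert_T] at this
    rw [map_mul, map_siteSum, map_mul]
    simp only [map_mul, map_pow, map_add, map_one, Polynomial.toLaurent_X, invert_T, h2]
    linear_combination (T (-1) ^ 2 * (T 1 * T (-1) + 1 + 2 * T (-1))
      * siteSum k 1 (1 + T (-1))) * h1
  rw [h, constantTerm_invert, constantTerm_toLaurent]
  simp

/-- The series `V` of the kernel method. -/
noncomputable def kernelSeries : ℚ[T;T⁻¹]⟦X⟧ :=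
  narayanaSeries (1 + T 1) ((1 + T 1) * T (-1))

theorem isUnit_of_coeff_zero_T {s : ℤ} {φ : ℚ[T;T⁻¹]⟦X⟧} (h : coeff 0 φ = T s) : IsUnit φ := by
  rw [PowerSeries.isUnit_iff_constantCoeff, ← coeff_zero_eq_constantCoeff_apply, h]
  exact isUnit_T s

theorem siteSeries_congr_kernelRhs (N : ℕ) :
    (X : ℚ[T;T⁻¹]⟦X⟧) ^ (N + 1) ∣
      siteSeries N X (1 + PowerSeries.C (T 1)) (1 + PowerSeries.C (T 1))
      + (1 + PowerSeries.C (T 1)) ^ 2 * PowerSeries.C (T (-1)) ^ 4 * X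
        * siteSeries N X 1 (1 + PowerSeries.C (T (-1)))
      - kernelRhs X (PowerSeries.C (T 1)) (PowerSeries.C (T (-1))) kernelSeries := by
  have hT : (T 1 * T (-1) : ℚ[T;T⁻¹]) = 1 := by
    rw [← T_add]
    simp
  have ha : (PowerSeries.C (T 1) * PowerSeries.C (T (-1)) : ℚ[T;T⁻¹]⟦X⟧) = 1 := by
    rw [← map_mul, hT, map_one]
  have hV0 : coeff 0 kernelSeries = 0 := coeff_zero_narayanaSeries _ _
  obtain ⟨U, hU⟩ := (isUnit_of_coeff_zero_T (s := 0) (φ := 1 + kernelSeries)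
    (by rw [map_add, hV0]; simp)).exists_left_inv
  obtain ⟨G, hG⟩ := (isUnit_of_coeff_zero_T (s := 1)
    (φ := PowerSeries.C (T 1) + (1 + PowerSeries.C (T 1)) * kernelSeries)
    (by
      rw [coeff_zero_eq_constantCoeff_apply] at hV0 ⊢
      simp [hV0])).exists_left_inv
  have hV : kernelSeries = X * PowerSeries.C (T (-1)) * (1 + PowerSeries.C (T 1))
      * (1 + kernelSeries) * (PowerSeries.C (T 1) + (1 + PowerSeries.C (T 1)) * kernelSeries) := by
    have h := narayanaSeries_eq (1 + T 1 : ℚ[T;T⁻¹]) ((1 + T 1) * T (-1))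
    rw [← kernelSeries, map_mul, map_add, map_one] at h
    linear_combination h - X * (1 + PowerSeries.C (T 1)) * (1 + kernelSeries) * ha
  rw [← Ideal.mem_span_singleton, ← Ideal.Quotient.eq_zero_iff_mem, map_sub, sub_eq_zero]
  have hx := Ideal.Quotient.eq_zero_iff_mem.mpr
    (Ideal.mem_span_singleton_self ((X : ℚ[T;T⁻¹]⟦X⟧) ^ (N + 1)))
  generalize Ideal.Quotient.mk (Ideal.span {(X : ℚ[T;T⁻¹]⟦X⟧) ^ (N + 1)}) = φ at *
  have := siteSeries_eq_kernelRhs (x := φ X) (N := N) (by rw [← map_pow, hx])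
    (by simpa using congrArg φ ha) (by simpa using congrArg φ hU) (by simpa using congrArg φ hG)
    (by simpa using congrArg φ hV)
  simpa [map_siteSeries, kernelRhs, map_ofNat φ 2] using this

theorem coeff_siteSeries (k : ℕ) (y z : ℚ[T;T⁻¹]) :
    coeff (k + 1) (siteSeries (k + 1) X (PowerSeries.C y) (PowerSeries.C z)) = siteSum k y z := by
  simp only [siteSeries, ← map_siteSum, map_sum, coeff_mul_C, coeff_X_pow]
  simp

theorem constantTerm_coeff_kernelSeries (i k : ℕ) (s : ℤ) :
    (k + 1) * constantTerm (T s * coeff (k + 1)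
      (((1 + PowerSeries.C (T 1)) * kernelSeries) ^ i)) =
    ∑ j ∈ Finset.range (k + 2), i * ((k + 1).choose j * (k + 1).choose (i + j))
      * constantTerm (T (s - j) * (1 + T 1) ^ (k + 1 + i + j)) := by
  have h : (1 + PowerSeries.C (T 1) : ℚ[T;T⁻¹]⟦X⟧) = PowerSeries.C (1 + T 1) := by simp
  rw [h, mul_pow, ← map_pow, coeff_C_mul, kernelSeries, coeff_narayanaSeries_pow, Finset.mul_sum,
    Finset.mul_sum, Finset.mul_sum, map_sum, Finset.mul_sum]
  refine Finset.sum_congr rfl fun j _ => ?_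
  have h1 : (T s * ((1 + T 1) ^ i * ((1 + T 1) ^ (k + 1)
      * (algebraMap ℚ ℚ[T;T⁻¹] (narayanaNumber i (k + 1) j) * ((1 + T 1) * T (-1)) ^ j))) :
        ℚ[T;T⁻¹]) =
      narayanaNumber i (k + 1) j • (T (s - j) * (1 + T 1) ^ (k + 1 + i + j)) := by
    rw [Algebra.smul_def, T_sub, mul_pow, T_pow, mul_neg_one]
    ring
  rw [h1, map_smul, narayanaNumber, smul_eq_mul, ← mul_assoc]
  congr 1
  push_cast
  field_simp

theorem constantTerm_coeff_kernelSeries_neg (i k r : ℕ) :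
    (k + 1) * constantTerm (T (-r) * coeff (k + 1)
      (((1 + PowerSeries.C (T 1)) * kernelSeries) ^ i)) =
    ∑ j ∈ Finset.range (k + 2), (i * ((k + 1).choose j * (k + 1).choose (i + j))
      * (k + 1 + i + j).choose (j + r) : ℚ) := by
  rw [constantTerm_coeff_kernelSeries]
  refine Finset.sum_congr rfl fun j _ => ?_
  rw [show (-r - j : ℤ) = -((j + r : ℕ) : ℤ) by push_cast; ring, constantTerm_T_neg_mul_pow]

theorem constantTerm_coeff_kernelSeries_one (k : ℕ) :
    (k + 1) * constantTerm (T 1 * coeff (k + 1) ((1 + PowerSeries.C (T 1)) * kernelSeries)) =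
    ∑ j ∈ Finset.range (k + 2), ((k + 1).choose j * (k + 1).choose (1 + j)
      * (k + 2 + j).choose (k + 3) : ℚ) := by
  have h := constantTerm_coeff_kernelSeries 1 k 1
  rw [pow_one] at h
  rw [h]
  refine Finset.sum_congr rfl fun j _ => ?_
  rw [Nat.cast_one, one_mul]
  congr 1
  rcases j with - | j
  · rw [Nat.choose_eq_zero_of_lt (by omega)]
    exact constantTerm_T_mul_pow_of_pos 1 _ one_pos
  · rw [show (1 - (j + 1 : ℕ) : ℤ) = -j by push_cast; ring, constantTerm_T_neg_mul_pow]
    rw [Nat.choose_symm_of_eq_add (show k + 2 + (j + 1) = (k + 3) + j by omega)]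

theorem mul_semiBaxterCount_eq_sum (k : ℕ) :
    (k + 1 : ℚ) * semiBaxterCount (k + 2) =
      ∑ j ∈ Finset.range (k + 2), lagrangeSummand (k + 1) j := by
  have h := congrArg constantTerm (X_pow_dvd_iff.mp (siteSeries_congr_kernelRhs (k + 2))
    (k + 2) (by omega))
  set W : ℚ[T;T⁻¹]⟦X⟧ := (1 + PowerSeries.C (T 1)) * kernelSeries with hW
  have h1 : kernelRhs X (PowerSeries.C (T 1)) (PowerSeries.C (T (-1))) kernelSeries =
      X * (PowerSeries.C ((1 + T 1) ^ 2) + PowerSeries.C (T (-(5 : ℕ)) + T (-(4 : ℕ))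
        + T (-(0 : ℕ)) + T (-(0 : ℕ)) + T 1 + T 1) * W ^ 1
      + PowerSeries.C (-T (-(5 : ℕ)) - T (-(4 : ℕ)) + T (-(3 : ℕ)) - T (-(2 : ℕ))
        - T (-(1 : ℕ)) + T (-(0 : ℕ))) * W ^ 2
      + PowerSeries.C (T (-(4 : ℕ)) - T (-(2 : ℕ))) * W ^ 3) := by
    have hp (r : ℕ) : (T (-r) : ℚ[T;T⁻¹]) = T (-1) ^ r := by
      rw [T_pow, mul_neg_one]
    rw [kernelRhs, ← hW]
    simp only [hp, map_add, map_sub, map_neg, map_pow, map_one, pow_zero, pow_one]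
    ring
  have h2 : siteSeries (k + 2) X (1 + PowerSeries.C (T 1)) (1 + PowerSeries.C (T 1)) =
      siteSeries (k + 2) X (PowerSeries.C (1 + T 1 : ℚ[T;T⁻¹])) (PowerSeries.C (1 + T 1)) := by
    simp
  have h3 : (1 + PowerSeries.C (T 1)) ^ 2 * PowerSeries.C (T (-1)) ^ 4 * X
        * siteSeries (k + 2) X 1 (1 + PowerSeries.C (T (-1))) =
      X * (PowerSeries.C ((1 + T 1 : ℚ[T;T⁻¹]) ^ 2 * T (-1) ^ 4)
        * (siteSeries (k + 1) X (PowerSeries.C 1) (PowerSeries.C (1 + T (-1)))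
          + X ^ (k + 2) * siteSum (k + 1) 1 (1 + PowerSeries.C (T (-1))))) := by
    rw [siteSeries, siteSeries, Finset.sum_range_succ]
    simp only [map_mul, map_pow, map_add, map_one]
    ring
  rw [h1, h2, h3, map_sub, map_add, coeff_siteSeries, coeff_succ_X_mul, coeff_succ_X_mul,
    coeff_C_mul, map_add, coeff_siteSeries, coeff_X_pow_mul', if_neg (by omega), add_zero,
    map_sub, map_add, constantTerm_siteSum, constantTerm_mul_siteSum] at h
  simp only [map_add, coeff_C_mul, coeff_succ_C, add_mul, sub_mul, neg_mul, map_sub, map_neg,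
    map_zero] at h
  let f (i r j : ℕ) : ℚ := i * ((k + 1).choose j * (k + 1).choose (i + j))
    * (k + 1 + i + j).choose (j + r)
  have e (i r : ℕ) : _ = ∑ j ∈ Finset.range (k + 2), f i r j :=
    constantTerm_coeff_kernelSeries_neg i k r
  have hl (j : ℕ) : lagrangeSummand (k + 1) j = f 1 5 j + f 1 4 j + 2 * f 1 0 j
      + 2 * ((k + 1).choose j * (k + 1).choose (1 + j) * (k + 2 + j).choose (k + 3))
      - f 2 5 j - f 2 4 j + f 2 3 j - f 2 2 j - f 2 1 j + f 2 0 j + f 3 4 j - f 3 2 j := by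
    simp only [lagrangeSummand, f, show k + 1 + 1 + j = k + 1 + j + 1 by omega,
      show k + 1 + 2 + j = k + 1 + j + 2 by omega, show k + 1 + 3 + j = k + 1 + j + 3 by omega,
      show k + 1 + 2 = k + 3 by omega,
      add_comm 1 j, add_comm 2 j, add_comm 3 j, add_zero]
    push_cast
    ring
  have e1 := constantTerm_coeff_kernelSeries_one k
  rw [← hW] at e1
  rw [← pow_one W] at e1
  simp only [← hW] at e
  rw [show ∑ j ∈ Finset.range (k + 2), lagrangeSummand (k + 1) j = _ from
    Finset.sum_congr rfl fun j _ => hl j]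
  simp only [Finset.sum_add_distrib, Finset.sum_sub_distrib, ← Finset.mul_sum, ← e, ← e1]
  linear_combination (k + 1 : ℚ) * h

end CoefficientExtraction

/-- Theorem 3.13, third closed formula for the semi-Baxter numbers. -/
theorem semiBaxter_closed_formula_three (n : ℕ) (hn : 2 ≤ n) :
    ((n : ℤ) - 1) * (n : ℤ) ^ 2 * ((n : ℤ) + 1) * ((n : ℤ) + 2) * (semiBaxterCount n : ℤ) =
      24 * ∑ j ∈ Finset.range (n + 1),
        (Nat.choose (n + 1) (j + 3) * Nat.choose (n + 2) (j + 1) * Nat.choose (n + j + 3) j : ℤ) := by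
  obtain ⟨k, rfl⟩ : ∃ k, n = k + 2 := ⟨n - 2, by omega⟩
  have h1 := mul_semiBaxterCount_eq_sum k
  have h2 := sum_lagrangeSummand (k + 1)
  have h3 : lagrangeSummand (k + 1) (k + 2) = 0 := by
    simp [lagrangeSummand, Nat.choose_eq_zero_of_lt]
  rw [Finset.sum_range_succ, h3, add_zero, ← h1] at h2
  have h : (((k + 2 : ℕ) : ℚ) - 1) * ((k + 2 : ℕ) : ℚ) ^ 2 * (((k + 2 : ℕ) : ℚ) + 1)
      * (((k + 2 : ℕ) : ℚ) + 2) * (semiBaxterCount (k + 2) : ℚ) =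
      24 * ∑ j ∈ Finset.range (k + 2 + 1), (Nat.choose (k + 2 + 1) (j + 3)
        * Nat.choose (k + 2 + 2) (j + 1) * Nat.choose (k + 2 + j + 3) j : ℚ) := by
    rw [show ∑ j ∈ Finset.range (k + 2 + 1), (Nat.choose (k + 2 + 1) (j + 3)
        * Nat.choose (k + 2 + 2) (j + 1) * Nat.choose (k + 2 + j + 3) j : ℚ) =
        ∑ j ∈ Finset.range (k + 1 + 2), ((k + 1 + 2).choose (j + 3) * (k + 1 + 3).choose (j + 1)
          * (k + 1 + j + 4).choose j : ℚ) from
      Finset.sum_congr rfl fun j _ => by rw [show k + 2 + j + 3 = k + 1 + j + 4 by omega], ← h2]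
    push_cast
    ring
  exact_mod_cast h
end
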